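/- arXiv:2001.09597 — 7 statements merged into one kernel-verified Lean document; each statement's English description precedes it below -/
import Mathlib

section
/- Let G be a finite totally 2-closed group and let P be a normal Sylow subgroup of G. Then P is cyclic or a generalized quaternion group. -/
def twoClosure {Ω : Type*} (H : Subgroup (Equiv.Perm Ω)) : Subgroup (Equiv.Perm Ω) where
  carrier := {θ | ∀ α β : Ω, ∃ h ∈ H, θ α = h α ∧ θ β = h β}
  one_mem' := fun α β => ⟨1, H.one_mem, rfl, rfl⟩
  mul_mem' := by
    intro a b ha hb α β
    obtain ⟨h₂, h₂H, e1, e2⟩ := hb α β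
    obtain ⟨h₁, h₁H, f1, f2⟩ := ha (b α) (b β)
    refine ⟨h₁ * h₂, H.mul_mem h₁H h₂H, ?_, ?_⟩
    · simp only [Equiv.Perm.mul_apply]; rw [f1, e1]
    · simp only [Equiv.Perm.mul_apply]; rw [f2, e2]
  inv_mem' := by
    intro a ha α β
    obtain ⟨h, hH, e1, e2⟩ := ha (a⁻¹ α) (a⁻¹ β)
    refine ⟨h⁻¹, H.inv_mem hH, ?_, ?_⟩
    · have h1 : h (a⁻¹ α) = α := by rw [← e1]; simp
      exact Equiv.Perm.eq_inv_iff_eq.mpr h1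
    · have h2 : h (a⁻¹ β) = β := by rw [← e2]; simp
      exact Equiv.Perm.eq_inv_iff_eq.mpr h2

def IsTotally2Closed (G : Type*) [Group G] : Prop :=
  ∀ (Ω : Type*) (H : Subgroup (Equiv.Perm Ω)), Nonempty (G ≃* H) → twoClosure H = H

def IsGeneralizedQuaternion (Q : Type*) [Group Q] : Prop :=
  ∃ m : ℕ, 1 ≤ m ∧ Nonempty (Q ≃* QuaternionGroup (2 ^ m))

def IsFittingSubgroup {G : Type*} [Group G] (F : Subgroup G) : Prop :=
  F.Normal ∧ Group.IsNilpotent F ∧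
    ∀ N : Subgroup G, N.Normal → Group.IsNilpotent N → N ≤ F

def IsMinimalNormal {X : Type*} [Group X] (M : Subgroup X) : Prop :=
  M.Normal ∧ M ≠ ⊥ ∧ ∀ N : Subgroup X, N.Normal → N ≤ M → N = ⊥ ∨ N = M

set_option linter.style.haveILetI false
universe u v

def T2 (G : Type u) [Group G] : Prop :=
  ∀ (Ω : Type u) [Finite Ω] [MulAction G Ω] [FaithfulSMul G Ω] (θ : Equiv.Perm Ω),
    (∀ α β, ∃ g : G, θ α = g • α ∧ θ β = g • β) → ∃ g : G, ∀ α, θ α = g • α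

theorem T2_of_isTotally2Closed (G : Type u) [Group G]
    (h : IsTotally2Closed.{u, v} G) : T2 G := by
  intro Ω _ _ _ θ hθ
  obtain ⟨n, ⟨e⟩⟩ := Finite.exists_equiv_fin Ω
  let e' : Ω ≃ ULift.{v} (Fin n) := e.trans Equiv.ulift.symm
  let f : G →* Equiv.Perm (ULift.{v} (Fin n)) :=
    (e'.permCongrHom.toMonoidHom).comp (MulAction.toPermHom G Ω)
  have hf : Function.Injective f := by
    refine (e'.permCongrHom.injective).comp MulAction.toPerm_injective
  have h1 := h (ULift.{v} (Fin n)) f.range ⟨f.ofInjective hf⟩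
  have h2 : e'.permCongrHom θ ∈ twoClosure f.range := by
    intro α β
    obtain ⟨g, h1, h2⟩ := hθ (e'.symm α) (e'.symm β)
    refine ⟨f g, ⟨g, rfl⟩, ?_, ?_⟩
    · simp [f, Equiv.permCongrHom, h1]
    · simp [f, Equiv.permCongrHom, h2]
  rw [h1] at h2
  obtain ⟨g, hg⟩ := h2
  refine ⟨g, fun α => ?_⟩
  have := e'.permCongrHom.injective hg
  rw [← this]; rfl

theorem T2_factor {G : Type u} [Group G] [Finite G] (h : T2 G) (M A : Subgroup G) [M.Normal]
    (hMA : ∀ g : G, ∃ m ∈ M, ∃ a ∈ A, g = m * a) (hc : M ⊓ A.normalCore = ⊥) (d : G) :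
    ∃ m ∈ M, ∃ a ∈ A.normalCore, d = m * a := by
  have hcore : ∀ g : G, (∀ x : G ⧸ A, g • x = x) → g ∈ A.normalCore := by
    intro g hg
    rw [Subgroup.normalCore_eq_ker, MonoidHom.mem_ker]
    ext x; exact hg x
  have hM : ∀ g : G, (∀ x : G ⧸ M, g • x = x) → g ∈ M := by
    intro g hg
    have := hg ((1 : G) : G ⧸ M)
    rw [MulAction.Quotient.smul_coe, QuotientGroup.eq] at this
    simpa using this
  have : FaithfulSMul G ((G ⧸ M) ⊕ (G ⧸ A)) := by
    refine ⟨fun {g g'} hg => ?_⟩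
    have h1 : g'⁻¹ * g ∈ M ⊓ A.normalCore := by
      refine ⟨hM _ fun x => ?_, hcore _ fun x => ?_⟩
      · have := hg (Sum.inl x)
        simp only [Sum.smul_inl, Sum.inl.injEq] at this
        rw [mul_smul, this, inv_smul_smul]
      · have := hg (Sum.inr x)
        simp only [Sum.smul_inr, Sum.inr.injEq] at this
        rw [mul_smul, this, inv_smul_smul]
    rw [hc, Subgroup.mem_bot, inv_mul_eq_one] at h1
    exact h1.symm
  obtain ⟨g, hg⟩ := h ((G ⧸ M) ⊕ (G ⧸ A)) (Equiv.sumCongr (MulAction.toPerm d) (Equiv.refl _)) (by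
    have key : ∀ (x : G ⧸ M) (y : G ⧸ A), ∃ k : G, d • x = k • x ∧ y = k • y := by
      intro x y
      induction x using QuotientGroup.induction_on with | _ x => ?_
      induction y using QuotientGroup.induction_on with | _ y => ?_
      obtain ⟨m, hm, a, ha, e⟩ := hMA (y⁻¹ * d * y)
      refine ⟨y * a * y⁻¹, ?_, ?_⟩
      · rw [MulAction.Quotient.smul_coe, MulAction.Quotient.smul_coe, QuotientGroup.eq]
        have e2 : a = m⁻¹ * (y⁻¹ * d * y) := by rw [e]; group
        have : (d • x)⁻¹ * (y * a * y⁻¹) • x = (x⁻¹ * d⁻¹ * y) * m⁻¹ * (x⁻¹ * d⁻¹ * y)⁻¹ := by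
          rw [e2]; simp only [smul_eq_mul]; group
        rw [this]
        exact Subgroup.Normal.conj_mem ‹_› _ (M.inv_mem hm) _
      · rw [MulAction.Quotient.smul_coe, QuotientGroup.eq]
        have : y⁻¹ * (y * a * y⁻¹) • y = a := by simp only [smul_eq_mul]; group
        rw [this]; exact ha
    rintro (x | x) (y | y)
    · exact ⟨d, rfl, rfl⟩
    · obtain ⟨k, h1, h2⟩ := key x y
      refine ⟨k, ?_, ?_⟩
      · simpa using h1
      · simpa using h2
    · obtain ⟨k, h1, h2⟩ := key y x
      refine ⟨k, ?_, ?_⟩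
      · simpa using h2
      · simpa using h1
    · exact ⟨1, by simp, by simp⟩)
  have g1 : g ∈ A.normalCore := hcore g fun x => by simpa using (hg (Sum.inr x)).symm
  have g2 : d * g⁻¹ ∈ M := by
    have := hM (g⁻¹ * d) fun x => by
      have := hg (Sum.inl x)
      simp only [Equiv.sumCongr_apply, Sum.map_inl, MulAction.toPerm_apply, Sum.smul_inl, Sum.inl.injEq] at this
      rw [mul_smul, this, inv_smul_smul]
    have h3 := Subgroup.Normal.conj_mem ‹M.Normal› _ this g
    convert h3 using 1; group
  exact ⟨_, g2, g, g1, by group⟩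

theorem T2_transfer {G Q : Type u} [Group G] [Finite G] [Group Q] (h : T2 G) (π : G →* Q)
    (P : Subgroup G) [P.Normal] (hs : ∀ q, ∃ x ∈ P, π x = q) (hi : ∀ x ∈ P, π x = 1 → x = 1) :
    T2 Q := by
  intro Ω _ _ _ θ hθ
  let : MulAction G Ω := MulAction.compHom Ω π
  have hsm : ∀ (g : G) (x : Ω), g • x = π g • x := fun _ _ => rfl
  have hP : ∀ g : G, (∀ x : G ⧸ P, g • x = x) → g ∈ P := by
    intro g hg
    have := hg ((1 : G) : G ⧸ P)
    rw [MulAction.Quotient.smul_coe, QuotientGroup.eq] at this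
    simpa using this
  have : FaithfulSMul G (Ω ⊕ (G ⧸ P)) := by
    refine ⟨fun {g g'} hg => ?_⟩
    have h1 : g'⁻¹ * g = 1 := by
      refine hi _ (hP _ fun x => ?_) (FaithfulSMul.eq_of_smul_eq_smul (α := Ω) fun x => ?_)
      · have := hg (Sum.inr x)
        simp only [Sum.smul_inr, Sum.inr.injEq] at this
        rw [mul_smul, this, inv_smul_smul]
      · have := hg (Sum.inl x)
        simp only [Sum.smul_inl, Sum.inl.injEq] at this
        rw [← hsm, mul_smul, this, inv_smul_smul, one_smul]
    rw [inv_mul_eq_one] at h1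
    exact h1.symm
  obtain ⟨g, hg⟩ := h (Ω ⊕ (G ⧸ P)) (Equiv.sumCongr θ (Equiv.refl _)) (by
    have key : ∀ x y : Ω, ∃ g ∈ P, θ x = g • x ∧ θ y = g • y := by
      intro x y
      obtain ⟨q, h1, h2⟩ := hθ x y
      obtain ⟨g, hg, rfl⟩ := hs q
      exact ⟨g, hg, h1, h2⟩
    have key2 : ∀ g ∈ P, ∀ x : G ⧸ P, g • x = x := by
      intro g hg x
      induction x using QuotientGroup.induction_on with | _ x => ?_
      rw [MulAction.Quotient.smul_coe, QuotientGroup.eq]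
      have h3 := Subgroup.Normal.conj_mem ‹P.Normal› _ (P.inv_mem hg) x⁻¹
      convert h3 using 1; simp only [smul_eq_mul]; group
    rintro (x | x) (y | y)
    · obtain ⟨g, hg, h1, h2⟩ := key x y
      exact ⟨g, by simp [h1], by simp [h2]⟩
    · obtain ⟨g, hg, h1, -⟩ := key x x
      exact ⟨g, by simp [h1], by simp [key2 g hg]⟩
    · obtain ⟨g, hg, h1, -⟩ := key y y
      exact ⟨g, by simp [key2 g hg], by simp [h1]⟩
    · exact ⟨1, by simp, by simp⟩)
  exact ⟨π g, fun x => by simpa [hsm] using hg (Sum.inl x)⟩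

theorem prime_inf {G : Type u} [Group G] {p : ℕ} [hp : Fact p.Prime] {M N : Subgroup G}
    (hM : Nat.card M = p) (hN : Nat.card N = p) (hne : M ≠ N) {x : G} (h1 : x ∈ M) (h2 : x ∈ N) :
    x = 1 := by
  by_contra hx
  have := Nat.finite_of_card_ne_zero (α := M) (by rw [hM]; exact hp.out.ne_zero)
  have := Nat.finite_of_card_ne_zero (α := N) (by rw [hN]; exact hp.out.ne_zero)
  have key : ∀ K : Subgroup G, Nat.card K = p → Finite K → x ∈ K → Subgroup.zpowers x = K := by
    intro K hK _ hxK
    apply Subgroup.eq_of_le_of_card_ge (by simpa using hxK)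
    have h3 : orderOf x ∣ p := by rw [← hK]; exact Subgroup.orderOf_dvd_natCard K hxK
    rcases (Nat.dvd_prime hp.out).1 h3 with h | h
    · exact absurd (orderOf_eq_one_iff.1 h) hx
    · rw [Nat.card_zpowers, h, hK]
  exact hne ((key M hM inferInstance h1).symm.trans (key N hN inferInstance h2))

theorem mem_sup_comm {G : Type u} [Group G] {s t : Subgroup G}
    (h : ∀ x ∈ s, ∀ y ∈ t, x * y = y * x) {n : G} (hn : n ∈ s ⊔ t) :
    ∃ x ∈ s, ∃ y ∈ t, n = x * y := by
  rw [Subgroup.sup_eq_closure] at hn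
  refine Subgroup.closure_induction ?_ ?_ ?_ ?_ hn
  · rintro x (hx | hx)
    · exact ⟨x, hx, 1, t.one_mem, by simp⟩
    · exact ⟨1, s.one_mem, x, hx, by simp⟩
  · exact ⟨1, s.one_mem, 1, t.one_mem, by simp⟩
  · rintro _ _ _ _ ⟨y₁, hy₁, z₁, hz₁, rfl⟩ ⟨y₂, hy₂, z₂, hz₂, rfl⟩
    refine ⟨y₁ * y₂, s.mul_mem hy₁ hy₂, z₁ * z₂, t.mul_mem hz₁ hz₂, ?_⟩
    rw [mul_assoc, ← mul_assoc z₁, ← h y₂ hy₂ z₁ hz₁]; simp only [mul_assoc]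
  · rintro _ _ ⟨y, hy, z, hz, rfl⟩
    refine ⟨y⁻¹, s.inv_mem hy, z⁻¹, t.inv_mem hz, ?_⟩
    rw [h y hy z hz, mul_inv_rev]

theorem T2_noV {G : Type u} [Group G] [Finite G] (h : T2 G) {p : ℕ} [hp : Fact p.Prime]
    (V : Subgroup G) [hV : V.Normal] (hcomm : ∀ x ∈ V, ∀ y ∈ V, x * y = y * x)
    (hexp : ∀ x ∈ V, x ^ p = 1) (hcard : Nat.card V = p ^ 2) : False := by
  classical
  let I := {M : Subgroup G // M ≤ V ∧ Nat.card M = p}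
  let Ω := Σ M : I, G ⧸ M.1
  have hzp : ∀ x ∈ V, x ≠ 1 → Subgroup.zpowers x ≤ V ∧ Nat.card (Subgroup.zpowers x) = p := by
    intro x hx hx1
    refine ⟨by simpa using hx, ?_⟩
    rw [Nat.card_zpowers]; exact orderOf_eq_prime (hexp x hx) hx1
  have hstab : ∀ (M : I) (g : G),
      MulAction.stabilizer G (⟨M, (g : G ⧸ M.1)⟩ : Ω) = M.1.map (MulAut.conj g).toMonoidHom := by
    intro M g
    ext x
    rw [MulAction.mem_stabilizer_iff]
    have : x • (⟨M, (g : G ⧸ M.1)⟩ : Ω) = ⟨M, ((x * g : G) : G ⧸ M.1)⟩ := rfl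
    rw [this, Sigma.mk.injEq]
    simp only [heq_eq_eq, true_and, QuotientGroup.eq, Subgroup.mem_map]
    constructor
    · intro hx
      exact ⟨_, M.1.inv_mem hx, by simp [mul_assoc]⟩
    · rintro ⟨y, hy, rfl⟩
      convert M.1.inv_mem hy using 1; simp [mul_assoc]
  have hst1 : ∀ M : I, MulAction.stabilizer G (⟨M, ((1 : G) : G ⧸ M.1)⟩ : Ω) = M.1 := by
    intro M; rw [hstab]; ext; simp
  have hst : ∀ α : Ω, MulAction.stabilizer G α ≤ V ∧ Nat.card (MulAction.stabilizer G α) = p := by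
    rintro ⟨M, x⟩
    induction x using QuotientGroup.induction_on with | _ g => ?_
    rw [hstab]
    constructor
    · rintro _ ⟨y, hy, rfl⟩
      exact hV.conj_mem y (M.2.1 hy) g
    · rw [Subgroup.card_map_of_injective (MulEquiv.injective _)]; exact M.2.2
  have hsm : ∀ n ∈ V, ∀ α : Ω, MulAction.stabilizer G (n • α) = MulAction.stabilizer G α := by
    intro n hn α
    have hh : ∀ n ∈ V, ∀ α : Ω, MulAction.stabilizer G (n • α) ≤ MulAction.stabilizer G α := by
      intro n hn α x hx
      have hxV := (hst _).1 hx
      rw [MulAction.mem_stabilizer_iff] at hx ⊢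
      rw [← mul_smul, hcomm x hxV n hn, mul_smul] at hx
      exact smul_left_cancel n hx
    refine le_antisymm (hh n hn α) ?_
    have := hh n⁻¹ (V.inv_mem hn) (n • α)
    rwa [inv_smul_smul] at this
  -- existence of elements
  have hex : ∀ x ∈ V, ∃ y ∈ V, y ∉ Subgroup.zpowers x := by
    intro x hx
    by_contra! hcon
    have h1 : Nat.card V ≤ Nat.card (Subgroup.zpowers x) := Subgroup.card_le_of_le hcon
    rw [Nat.card_zpowers, hcard] at h1
    have h2 := Nat.le_of_dvd hp.out.pos (orderOf_dvd_of_pow_eq_one (hexp x hx))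
    nlinarith [hp.out.two_le]
  obtain ⟨n, hn, hn1⟩ := hex 1 V.one_mem
  have hn1 : n ≠ 1 := fun h => hn1 (by simp [h])
  obtain ⟨m, hm, hmn⟩ := hex n hn
  have hm1 : m ≠ 1 := fun h => hmn (by simp [h, one_mem])
  let M0 : I := ⟨Subgroup.zpowers m, hzp m hm hm1⟩
  let M1 : I := ⟨Subgroup.zpowers n, hzp n hn hn1⟩
  have hnm : n * m ≠ 1 := fun h => hmn (by rw [eq_inv_of_mul_eq_one_right h]; simp)
  let M2 : I := ⟨Subgroup.zpowers (n * m), hzp (n * m) (V.mul_mem hn hm) hnm⟩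
  have h01 : M0.1 ≠ M1.1 := fun h => hmn (by
    have : m ∈ M0.1 := Subgroup.mem_zpowers m
    rw [h] at this; exact this)
  have hnM0 : n ∉ M0.1 := fun hh => hn1 (prime_inf M0.2.2 M1.2.2 h01 hh (Subgroup.mem_zpowers n))
  have h12 : M1.1 ≠ M2.1 := fun h => hmn (by
    have h3 : n * m ∈ M2.1 := Subgroup.mem_zpowers _
    rw [← h] at h3
    exact (Subgroup.mul_mem_cancel_left _ (Subgroup.mem_zpowers n)).1 h3)
  have h02 : M0.1 ≠ M2.1 := fun h => hnM0 (by
    have h3 : n * m ∈ M2.1 := Subgroup.mem_zpowers _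
    rw [← h] at h3
    exact (Subgroup.mul_mem_cancel_right _ (Subgroup.mem_zpowers m)).1 h3)
  have : FaithfulSMul G Ω := by
    refine ⟨fun {g g'} hg => ?_⟩
    have hh : ∀ M : I, g'⁻¹ * g ∈ M.1 := by
      intro M
      rw [← hst1 M, MulAction.mem_stabilizer_iff, mul_smul, hg, inv_smul_smul]
    have := prime_inf M0.2.2 M1.2.2 h01 (hh M0) (hh M1)
    rw [inv_mul_eq_one] at this
    exact this.symm
  let t : G → Ω → Ω := fun n α => if MulAction.stabilizer G α = M0.1 then n • α else α
  have ht : ∀ n ∈ V, ∀ α, t n⁻¹ (t n α) = α := by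
    intro n hn α
    by_cases hα : MulAction.stabilizer G α = M0.1
    · have : MulAction.stabilizer G (n • α) = M0.1 := by rw [hsm n hn, hα]
      simp only [t, hα, this, if_true, inv_smul_smul]
    · simp only [t, hα, if_false]
  let θ : Equiv.Perm Ω := ⟨t n, t n⁻¹, ht n hn, fun α => by
    simpa using ht n⁻¹ (V.inv_mem hn) α⟩
  have key : ∀ α β : Ω, MulAction.stabilizer G α = M0.1 → MulAction.stabilizer G β ≠ M0.1 →
      ∃ g : G, n • α = g • α ∧ β = g • β := by
    intro α β hα hβ
    have hsup : MulAction.stabilizer G β ⊔ M0.1 = V := by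
      apply Subgroup.eq_of_le_of_card_ge (sup_le (hst β).1 M0.2.1)
      have d1 : p ∣ Nat.card (MulAction.stabilizer G β ⊔ M0.1 : Subgroup G) := by
        conv_lhs => rw [← M0.2.2]
        exact Subgroup.card_dvd_of_le le_sup_right
      have d2 : Nat.card (MulAction.stabilizer G β ⊔ M0.1 : Subgroup G) ∣ p ^ 2 := by
        rw [← hcard]; exact Subgroup.card_dvd_of_le (sup_le (hst β).1 M0.2.1)
      obtain ⟨k, hk, hk'⟩ := (Nat.dvd_prime_pow hp.out).1 d2
      rw [hcard, hk']
      by_contra hlt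
      have hk1 : k ≤ 1 := by
        by_contra hk2
        have : k = 2 := by omega
        subst this; exact hlt le_rfl
      have hle : Nat.card (MulAction.stabilizer G β ⊔ M0.1 : Subgroup G) ≤ p := by
        rw [hk']; calc p ^ k ≤ p ^ 1 := Nat.pow_le_pow_right hp.out.pos hk1
          _ = p := pow_one p
      have e1 := Subgroup.eq_of_le_of_card_ge (le_sup_left : MulAction.stabilizer G β ≤ _ ⊔ M0.1)
        (by rw [(hst β).2]; exact hle)
      have e2 := Subgroup.eq_of_le_of_card_ge (le_sup_right : M0.1 ≤ MulAction.stabilizer G β ⊔ _)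
        (by rw [M0.2.2]; exact hle)
      exact hβ (e1.trans e2.symm)
    have hnV : n ∈ MulAction.stabilizer G β ⊔ M0.1 := by rw [hsup]; exact hn
    have : ∃ x ∈ MulAction.stabilizer G β, ∃ y ∈ M0.1, n = x * y := by
      exact mem_sup_comm (fun x hx y hy => hcomm x ((hst β).1 hx) y (M0.2.1 hy)) hnV
    obtain ⟨x, hx, y, hy, e⟩ := this
    rw [← hα, MulAction.mem_stabilizer_iff] at hy
    exact ⟨x, by rw [e, mul_smul, hy], (MulAction.mem_stabilizer_iff.1 hx).symm⟩
  obtain ⟨g, hg⟩ := h Ω θ (by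
    intro α β
    change ∃ g : G, t n α = g • α ∧ t n β = g • β
    by_cases hα : MulAction.stabilizer G α = M0.1 <;>
    by_cases hβ : MulAction.stabilizer G β = M0.1 <;> simp only [t, hα, hβ, if_true, if_false]
    · exact ⟨n, rfl, rfl⟩
    · exact key α β hα hβ
    · obtain ⟨g, h1, h2⟩ := key β α hβ hα
      exact ⟨g, h2, h1⟩
    · exact ⟨1, by simp, by simp⟩)
  have hg' : ∀ M : I, M.1 ≠ M0.1 → g ∈ M.1 := by
    intro M hM
    have := hg ⟨M, ((1 : G) : G ⧸ M.1)⟩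
    change t n _ = _ at this
    simp only [t, hst1, hM, if_false] at this
    rw [← hst1 M]
    exact this.symm
  have g1 : g = 1 := prime_inf M1.2.2 M2.2.2 h12 (hg' M1 h01.symm) (hg' M2 h02.symm)
  have := hg ⟨M0, ((1 : G) : G ⧸ M0.1)⟩
  change t n _ = _ at this
  simp only [t, hst1, if_true, g1, one_smul] at this
  apply hnM0
  rw [← hst1 M0]
  exact this

theorem pgroup_next {P : Type u} [Group P] [Finite P] {p : ℕ} [hp : Fact p.Prime]
    (hP : IsPGroup p P) (A B : Subgroup P) [A.Normal] [hB : B.Normal] (hAB : A < B) :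
    ∃ b ∈ B, b ∉ A ∧ ∀ g, g * b * g⁻¹ * b⁻¹ ∈ A := by
  let C := B.map (QuotientGroup.mk' A)
  have : C.Normal := Subgroup.Normal.map hB _ (QuotientGroup.mk'_surjective A)
  obtain ⟨b, hb, hbA⟩ := SetLike.exists_of_lt hAB
  have hC : p ∣ Nat.card C := by
    have h1 := (hP.to_quotient A).to_subgroup C
    rcases h1.card_eq_or_dvd with h | h
    · exfalso
      have := Subgroup.eq_bot_of_card_eq C h
      have hb' : (QuotientGroup.mk' A b) ∈ C := ⟨b, hb, rfl⟩
      rw [this, Subgroup.mem_bot] at hb'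
      exact hbA ((QuotientGroup.eq_one_iff b).1 hb')
    · exact h
  obtain ⟨⟨x, y, hy, hx⟩, hfix, hne⟩ :=
    ((hP.to_quotient A).of_equiv ConjAct.toConjAct).exists_fixed_point_of_prime_dvd_card_of_fixed_point
      C hC (a := 1) (by intro g; simp)
  refine ⟨y, hy, ?_, ?_⟩
  · intro hyA
    apply hne
    ext
    have : (y : P ⧸ A) = 1 := (QuotientGroup.eq_one_iff y).2 hyA
    simp only [Subgroup.coe_one]
    rw [← hx]; exact this.symm
  · intro g
    have h1 := congrArg Subtype.val (hfix (ConjAct.toConjAct (g : P ⧸ A)))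
    rw [ConjAct.Subgroup.val_conj_smul, ConjAct.toConjAct_smul] at h1
    simp only at h1
    rw [← QuotientGroup.eq_one_iff]
    rw [← hx] at h1
    have h2 : (g : P ⧸ A) * y * (g : P ⧸ A)⁻¹ = y := h1
    rw [QuotientGroup.mk_mul, QuotientGroup.mk_mul, QuotientGroup.mk_mul, QuotientGroup.mk_inv,
      QuotientGroup.mk_inv, h2, mul_inv_cancel]

theorem T2_noE {P : Type u} [Group P] [Finite P] (h : T2 P) {p : ℕ} [hp : Fact p.Prime] (y z : P)
    (hz : z ^ p = 1) (hy : y ^ p = 1) (hz1 : z ≠ 1) (hyz : y ∉ Subgroup.zpowers z)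
    (hc : ∀ g, g * z = z * g)
    (hn : ∀ g, g * y * g⁻¹ ∈ Subgroup.zpowers z ⊔ Subgroup.zpowers y) : False := by
  have hzy : ∀ x ∈ Subgroup.zpowers z, ∀ g, g * x = x * g := by
    rintro x ⟨i, rfl⟩ g
    exact (Commute.zpow_right (hc g) i : Commute g (z ^ i))
  have hmem : ∀ {n : P}, n ∈ Subgroup.zpowers z ⊔ Subgroup.zpowers y →
      ∃ x ∈ Subgroup.zpowers z, ∃ v ∈ Subgroup.zpowers y, n = x * v :=
    fun hn => mem_sup_comm (fun x hx v _ => (hzy x hx v).symm) hn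
  have hyy : ∀ a ∈ Subgroup.zpowers y, ∀ b ∈ Subgroup.zpowers y, a * b = b * a := by
    rintro _ ⟨i, rfl⟩ _ ⟨j, rfl⟩
    exact ((Commute.refl y).zpow_zpow i j)
  have hy1 : y ≠ 1 := fun h => hyz (by rw [h]; exact one_mem _)
  have oy : Nat.card (Subgroup.zpowers y) = p := by
    rw [Nat.card_zpowers]; exact orderOf_eq_prime hy hy1
  have oz : Nat.card (Subgroup.zpowers z) = p := by
    rw [Nat.card_zpowers]; exact orderOf_eq_prime hz hz1
  have hne : Subgroup.zpowers z ≠ Subgroup.zpowers y :=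
    fun h => hyz (by rw [h]; exact Subgroup.mem_zpowers y)
  have hnorm : (Subgroup.zpowers z ⊔ Subgroup.zpowers y).Normal := by
    refine ⟨fun n hn' g => ?_⟩
    obtain ⟨x, hx, v, ⟨j, rfl⟩, rfl⟩ := hmem hn'
    have : g * (x * y ^ j) * g⁻¹ = x * (g * y * g⁻¹) ^ j := by
      rw [conj_zpow, ← mul_assoc, hzy x hx g]; simp only [mul_assoc]
    simp only [this]
    exact Subgroup.mul_mem _ (Subgroup.mem_sup_left hx) (Subgroup.zpow_mem _ (hn g) j)
  refine T2_noV h (p := p) (Subgroup.zpowers z ⊔ Subgroup.zpowers y) ?_ ?_ ?_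
  · intro a ha b hb
    obtain ⟨x, hx, v, hv, rfl⟩ := hmem ha
    obtain ⟨x', hx', v', hv', rfl⟩ := hmem hb
    have e1 := hzy x hx (x' * v')
    have e2 := hzy x' hx' v
    calc x * v * (x' * v') = x * (v * x') * v' := by group
      _ = x * x' * (v * v') := by rw [e2]; group
      _ = x * (x' * v') * v := by rw [hyy v hv v' hv']; group
      _ = x' * v' * (x * v) := by rw [← e1]; group
  · intro a ha
    obtain ⟨x, hx, v, hv, rfl⟩ := hmem ha
    have : Commute x v := (hzy x hx v).symm
    rw [this.mul_pow]
    obtain ⟨i, rfl⟩ := hx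
    obtain ⟨j, rfl⟩ := hv
    simp only
    rw [← zpow_natCast, ← zpow_mul, mul_comm, zpow_mul, zpow_natCast, hz, one_zpow, ← zpow_natCast,
      ← zpow_mul, mul_comm, zpow_mul, zpow_natCast, hy, one_zpow, one_mul]
  · have : Nat.card (Subgroup.zpowers z × Subgroup.zpowers y) = p ^ 2 := by
      rw [Nat.card_prod, oy, oz, sq]
    rw [← this]
    symm
    refine Nat.card_eq_of_bijective
      (fun q : Subgroup.zpowers z × Subgroup.zpowers y =>
        (⟨q.1.1 * q.2.1, Subgroup.mul_mem _ (Subgroup.mem_sup_left q.1.2)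
          (Subgroup.mem_sup_right q.2.2)⟩ : (Subgroup.zpowers z ⊔ Subgroup.zpowers y : Subgroup P)))
      ⟨?_, ?_⟩
    · rintro ⟨⟨a, ha⟩, ⟨b, hb⟩⟩ ⟨⟨a', ha'⟩, ⟨b', hb'⟩⟩ hab
      simp only [Subtype.mk.injEq] at hab
      have e : a'⁻¹ * a = b' * b⁻¹ := by
        rw [eq_mul_inv_iff_mul_eq, mul_assoc, hab]; group
      have h1 : a'⁻¹ * a = 1 := prime_inf oz oy hne (mul_mem (inv_mem ha') ha)
        (by rw [e]; exact mul_mem hb' (inv_mem hb))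
      rw [h1] at e
      simp only [Prod.mk.injEq, Subtype.mk.injEq]
      exact ⟨(inv_mul_eq_one.1 h1).symm, (mul_inv_eq_one.1 e.symm).symm⟩
    · rintro ⟨n, hn'⟩
      obtain ⟨x, hx, v, hv, rfl⟩ := hmem hn'
      exact ⟨(⟨x, hx⟩, ⟨v, hv⟩), rfl⟩

theorem pstep {P : Type u} [Group P] {p : ℕ} (hP : IsPGroup p P) (A : Subgroup P) {x : P}
    (hx : x ∉ A) : ∃ k : ℕ, x ^ p ^ k ∉ A ∧ (x ^ p ^ k) ^ p ∈ A := by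
  classical
  have hex : ∃ k, x ^ p ^ k ∈ A := by
    obtain ⟨k, hk⟩ := isPGroup_iff_pow_pow_eq_one.1 hP x
    exact ⟨k, by rw [hk]; exact A.one_mem⟩
  obtain ⟨k, hk⟩ : ∃ k, Nat.find hex = k + 1 := by
    refine Nat.exists_eq_succ_of_ne_zero fun h0 => hx ?_
    have := Nat.find_spec hex
    rw [h0] at this; simpa using this
  refine ⟨k, Nat.find_min hex (by omega), ?_⟩
  have := Nat.find_spec hex
  rwa [hk, pow_succ, pow_mul] at this

theorem cyc_of_unique {P : Type u} [Group P] [Finite P] {p : ℕ} [hp : Fact p.Prime]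
    (hP : IsPGroup p P) (N : Subgroup P) (hcomm : ∀ x ∈ N, ∀ y ∈ N, x * y = y * x) (z : P)
    (hzN : z ∈ N) (hz : z ^ p = 1) (hz1 : z ≠ 1)
    (hu : ∀ x ∈ N, x ^ p = 1 → x ∈ Subgroup.zpowers z) : ∃ c ∈ N, N = Subgroup.zpowers c := by
  obtain ⟨⟨c, hcN⟩, hc⟩ := Finite.exists_max (fun x : N => orderOf (x : P))
  obtain ⟨n, hn⟩ := IsPGroup.iff_orderOf.1 hP c
  have hoz : orderOf z = p := orderOf_eq_prime hz hz1
  have hmax : ∀ x ∈ N, x ^ p ^ n = 1 := by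
    intro x hx
    obtain ⟨k, hk⟩ := IsPGroup.iff_orderOf.1 hP x
    have h1 := hc ⟨x, hx⟩
    simp only [hk, hn] at h1
    rw [← orderOf_dvd_iff_pow_eq_one, hk]
    exact pow_dvd_pow p ((Nat.pow_le_pow_iff_right hp.out.one_lt).1 h1)
  have hn0 : n ≠ 0 := by
    rintro rfl
    have := hmax z hzN
    simp at this; exact hz1 this
  obtain ⟨m, rfl⟩ := Nat.exists_eq_succ_of_ne_zero hn0
  have hw1 : c ^ p ^ m ≠ 1 := by
    intro h
    rw [← orderOf_dvd_iff_pow_eq_one, hn, Nat.pow_dvd_pow_iff_le_right hp.out.one_lt] at h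
    omega
  have hwp : (c ^ p ^ m) ^ p = 1 := by
    rw [← pow_mul, ← pow_succ]; exact hmax c hcN
  have hzc : Subgroup.zpowers z ≤ Subgroup.zpowers c := by
    have : Subgroup.zpowers z = Subgroup.zpowers (c ^ p ^ m) := by
      by_contra hne
      refine hw1 (prime_inf (p := p) ?_ ?_ hne (hu _ (N.pow_mem hcN _) hwp) (Subgroup.mem_zpowers _))
      · rw [Nat.card_zpowers, hoz]
      · rw [Nat.card_zpowers]; exact orderOf_eq_prime hwp hw1
    rw [this, Subgroup.zpowers_le]
    exact Subgroup.pow_mem _ (Subgroup.mem_zpowers c) _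
  refine ⟨c, hcN, le_antisymm ?_ (by simpa using hcN)⟩
  intro x₀ hx₀
  by_contra hx₀c
  obtain ⟨k, hk1, hk2⟩ := pstep hP _ hx₀c
  set x := x₀ ^ p ^ k with hx
  have hxN : x ∈ N := N.pow_mem hx₀ _
  obtain ⟨i, hi⟩ := hk2
  simp only at hi
  have h1 : c ^ (i * (p : ℤ) ^ m) = 1 := by
    have e : c ^ (i * (p : ℤ) ^ m) = (c ^ i) ^ (p ^ m) := by
      rw [zpow_mul]; exact_mod_cast rfl
    rw [e, hi, ← pow_mul, ← pow_succ']
    exact hmax x hxN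
  rw [← orderOf_dvd_iff_zpow_eq_one, hn] at h1
  have h2 : (p : ℤ) ∣ i := by
    rw [Nat.succ_eq_add_one] at h1
    push_cast at h1
    rw [pow_succ', mul_comm i, mul_comm (p : ℤ)] at h1
    exact Int.dvd_of_mul_dvd_mul_left (pow_ne_zero _ (by exact_mod_cast hp.out.ne_zero)) h1
  obtain ⟨j, rfl⟩ := h2
  have hxc : Commute x (c ^ (-j)) := hcomm x hxN _ (N.zpow_mem hcN _)
  have h3 : (x * c ^ (-j)) ^ p = 1 := by
    rw [hxc.mul_pow, ← hi, ← zpow_natCast (c ^ (-j)), ← zpow_mul, ← zpow_add]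
    have : (p : ℤ) * j + -j * p = 0 := by ring
    rw [this, zpow_zero]
  have h4 := hzc (hu _ (N.mul_mem hxN (N.zpow_mem hcN _)) h3)
  exact hk1 ((Subgroup.mul_mem_cancel_right _ (Subgroup.zpow_mem _ (Subgroup.mem_zpowers c) _)).1 h4)

theorem comm_form1 {P : Type u} [Group P] {c g w : P} (hw : ∀ x, x * w = w * x)
    (h : g * c = c * w * g) (k : ℕ) (a : ℤ) : g ^ k * c ^ a = c ^ a * w ^ (a * k) * g ^ k := by
  have h1 : ∀ k : ℕ, g ^ k * c * (g ^ k)⁻¹ = c * w ^ k := by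
    intro k
    induction k with
    | zero => simp
    | succ k ih =>
      rw [pow_succ' g]
      calc g * g ^ k * c * (g * g ^ k)⁻¹ = g * (g ^ k * c * (g ^ k)⁻¹) * g⁻¹ := by group
        _ = g * c * w ^ k * g⁻¹ := by rw [ih]; group
        _ = c * w * (g * w ^ k) * g⁻¹ := by rw [h]; group
        _ = c * w * (w ^ k * g) * g⁻¹ := by rw [(show Commute g w from hw g).pow_right k]
        _ = c * w ^ (k + 1) := by rw [pow_succ']; group
  have h2 : g ^ k * c ^ a * (g ^ k)⁻¹ = c ^ a * w ^ (a * k) := by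
    rw [← conj_zpow, h1, ((show Commute c w from hw c).pow_right k).mul_zpow, ← zpow_natCast,
      ← zpow_mul, mul_comm (k : ℤ)]
  rw [← h2]; group

theorem comm_form2 {P : Type u} [Group P] {c g w : P} (hw : ∀ x, x * w = w * x)
    (h : g * c = c * w * g) (a : ℤ) (k : ℕ) :
    (c ^ a * g) ^ k = c ^ (a * k) * w ^ (a * (k.choose 2 : ℕ)) * g ^ k := by
  induction k with
  | zero => simp
  | succ k ih =>
    have hwx : ∀ (i : ℤ) (x : P), w ^ i * x = x * w ^ i :=
      fun i x => ((show Commute x w from hw x).zpow_right i).symm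
    rw [pow_succ, ih]
    calc c ^ (a * k) * w ^ (a * (k.choose 2 : ℕ)) * g ^ k * (c ^ a * g)
        = c ^ (a * k) * w ^ (a * (k.choose 2 : ℕ)) * (g ^ k * c ^ a) * g := by group
      _ = c ^ (a * k) * (w ^ (a * (k.choose 2 : ℕ)) * c ^ a) * w ^ (a * k) * (g ^ k * g) := by
          rw [comm_form1 hw h]; simp only [mul_assoc]
      _ = (c ^ (a * k) * c ^ a) * (w ^ (a * (k.choose 2 : ℕ)) * w ^ (a * k)) * (g ^ k * g) := by
          rw [hwx]; simp only [mul_assoc]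
      _ = _ := by
          rw [← zpow_add, ← zpow_add, ← pow_succ, Nat.choose_succ_succ' k 1, Nat.choose_one_right]
          push_cast
          congr 3 <;> ring_nf

theorem claim1 {P : Type u} [Group P] [Finite P] (h : T2 P) {p : ℕ} [hp : Fact p.Prime]
    (hP : IsPGroup p P) (c g w : P) [hN : (Subgroup.zpowers c).Normal]
    (hself : ∀ x, x * c = c * x → x ∈ Subgroup.zpowers c) (hwN : w ∈ Subgroup.zpowers c)
    (hw : ∀ x, x * w = w * x) (hwp : w ^ p = 1) (hgc : g * c = c * w * g)
    (hg : g ∉ Subgroup.zpowers c)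
    (hu : ∀ x ∈ Subgroup.zpowers c, x ^ p = 1 → x ∈ Subgroup.zpowers w) (e : ℤ)
    (he : w ^ (p.choose 2) = c ^ ((p : ℤ) * p * e)) : False := by
  have hw1 : w ≠ 1 := by
    rintro rfl
    exact hg (hself g (by simpa using hgc))
  have how : orderOf w = p := orderOf_eq_prime hwp hw1
  obtain ⟨n, hn⟩ := IsPGroup.iff_orderOf.1 hP c
  have hcop : ∀ t : ℤ, IsCoprime (1 + p * t) ((p : ℤ) ^ n) := by
    intro t
    apply IsCoprime.pow_right
    exact ⟨1, -t, by ring⟩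
  have hcn : ∀ i : ℤ, c ^ i = 1 ↔ (p : ℤ) ^ n ∣ i := by
    intro i; rw [← orderOf_dvd_iff_zpow_eq_one, hn]; push_cast; rfl
  have hgp : g ^ p ∈ Subgroup.zpowers c := by
    apply hself
    have := comm_form1 hw hgc p 1
    simpa [hwp] using this
  obtain ⟨i, hi⟩ := hgp
  simp only at hi
  have hpi : (p : ℤ) ∣ i := by
    have h1 := comm_form1 hw hgc 1 i
    rw [pow_one, hi, ← pow_succ', ← hi] at h1
    rw [← how, orderOf_dvd_iff_zpow_eq_one]
    have h2 : c ^ i * w ^ (i * ((1 : ℕ) : ℤ)) * g = c ^ i * g := by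
      rw [← h1, pow_succ, hi]
    have h3 := mul_right_cancel h2
    simpa using h3
  obtain ⟨j, rfl⟩ := hpi
  obtain ⟨x, y', hxy⟩ := hcop e
  obtain ⟨a, ha⟩ : ∃ a : ℤ, a = -j * x := ⟨_, rfl⟩
  have hy : (c ^ a * g) ^ p = 1 := by
    rw [comm_form2 hw hgc, ← hi, mul_comm a (p.choose 2 : ℤ), zpow_mul w, zpow_natCast w, he, ← zpow_mul, ← zpow_add,
      ← zpow_add, hcn]
    refine ⟨p * j * y', ?_⟩
    rw [ha]; linear_combination (-(p:ℤ) * j) * hxy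
  have hyc : (c ^ a * g) * c = c * w * (c ^ a * g) := by
    rw [mul_assoc, hgc]
    calc c ^ a * (c * w * g) = c * (c ^ a * w) * g := by group
      _ = _ := by rw [hw]; simp only [mul_assoc]
  have hyN : c ^ a * g ∉ Subgroup.zpowers c := fun hh =>
    hg ((Subgroup.mul_mem_cancel_left _ (Subgroup.zpow_mem _ (Subgroup.mem_zpowers c) _)).1 hh)
  generalize c ^ a * g = y at hy hyc hyN
  refine T2_noE h y w hwp hy hw1 (fun hh => hyN ?_) hw ?_
  · exact (Subgroup.zpowers_le.2 hwN) hh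
  intro f
  have hfc : f⁻¹ * c * f ∈ Subgroup.zpowers c := by
    simpa using hN.conj_mem c (Subgroup.mem_zpowers c) f⁻¹
  rw [← mem_powers_iff_mem_zpowers] at hfc
  obtain ⟨t, ht⟩ := hfc
  simp only at ht
  have e1 : (f * y * f⁻¹) * c = c * w ^ t * (f * y * f⁻¹) := by
    have h1 : y * c ^ t = c ^ t * w ^ t * y := by
      have := comm_form1 hw hyc 1 t
      simpa using this
    have hwf : f * (c ^ t * w ^ t) = f * c ^ t * f⁻¹ * w ^ t * f := by
      have : Commute f (w ^ t) := (show Commute f w from hw f).pow_right t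
      rw [mul_assoc _ (w ^ t) f, ← this.eq]; group
    calc (f * y * f⁻¹) * c = f * (y * (f⁻¹ * c * f)) * f⁻¹ := by group
      _ = f * (c ^ t * w ^ t) * y * f⁻¹ := by rw [← ht, h1]; simp only [mul_assoc]
      _ = f * (f⁻¹ * c * f) * f⁻¹ * w ^ t * f * y * f⁻¹ := by rw [hwf, ht]
      _ = _ := by group
  generalize hy' : f * y * f⁻¹ = y2 at e1
  have hy2 : y2 ^ p = 1 := by rw [← hy', conj_pow, hy]; simp
  have hwt : ∀ x, x * w ^ t = w ^ t * x := fun x => (show Commute x w from hw x).pow_right t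
  have e2 : y ^ t * c = c * w ^ t * y ^ t := by
    have := comm_form1 hw hyc t 1
    simpa using this
  have hq : y2 * (y ^ t)⁻¹ ∈ Subgroup.zpowers c := by
    apply hself
    have e3 : (y ^ t)⁻¹ * c * w ^ t = c * (y ^ t)⁻¹ := by
      rw [mul_assoc, inv_mul_eq_iff_eq_mul, ← mul_assoc, e2]; 
      rw [mul_assoc, mul_assoc, ← mul_assoc _ _ (y ^ t)⁻¹]
      rw [mul_assoc (w ^ t), mul_inv_cancel, mul_one]
    have : y2 * (y ^ t)⁻¹ * c * w ^ t = c * (y2 * (y ^ t)⁻¹) * w ^ t := by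
      calc y2 * (y ^ t)⁻¹ * c * w ^ t = y2 * ((y ^ t)⁻¹ * c * w ^ t) := by simp only [mul_assoc]
        _ = c * w ^ t * y2 * (y ^ t)⁻¹ := by rw [e3, ← mul_assoc, e1]
        _ = c * (w ^ t * (y2 * (y ^ t)⁻¹)) := by simp only [mul_assoc]
        _ = _ := by rw [← hwt]; simp only [mul_assoc]
    exact mul_right_cancel this
  obtain ⟨i, hi⟩ := hq
  simp only at hi
  have hy2e : y2 = c ^ i * y ^ t := by rw [hi]; group
  have e4 := comm_form2 hwt e2 i p
  rw [← hy2e, hy2, ← pow_mul y, mul_comm t, pow_mul, hy, one_pow, mul_one, ← zpow_natCast w t, ← zpow_mul,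
    show ((t : ℤ) * (i * (p.choose 2 : ℕ))) = (p.choose 2 : ℕ) * (t * i) by ring, zpow_mul w,
    zpow_natCast w (p.choose 2), he, ← zpow_mul, ← zpow_add] at e4
  have e5 := (hcn _).1 e4.symm
  rw [show i * (p : ℤ) + p * p * e * (t * i) = (1 + p * (e * t)) * (i * p) by ring] at e5
  have e6 := (hcop (e * t)).symm.dvd_of_dvd_mul_left e5
  rw [← hcn, zpow_mul, zpow_natCast] at e6
  rw [hy2e]
  exact Subgroup.mul_mem _ (Subgroup.mem_sup_left (hu _ (Subgroup.zpow_mem _ (Subgroup.mem_zpowers c) _) e6))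
    (Subgroup.mem_sup_right (Subgroup.pow_mem _ (Subgroup.mem_zpowers y) _))
theorem structA {P : Type u} [Group P] [Finite P] [Nontrivial P] (h : T2 P) {p : ℕ}
    [hp : Fact p.Prime] (hP : IsPGroup p P) :
    ∃ c z : P, (Subgroup.zpowers c).Normal ∧ (∀ x, x * c = c * x → x ∈ Subgroup.zpowers c) ∧
      z ≠ 1 ∧ z ^ p = 1 ∧ z ∈ Subgroup.zpowers c ∧ (∀ g, g * z = z * g) ∧
      (∀ x ∈ Subgroup.zpowers c, x ^ p = 1 → x ∈ Subgroup.zpowers z) := by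
  let S : Set (Subgroup P) := {N | N.Normal ∧ ∀ x ∈ N, ∀ y ∈ N, x * y = y * x}
  have hSne : S.Nonempty := ⟨⊥, inferInstance, by
    intro x hx y hy
    rw [Subgroup.mem_bot] at hx hy
    rw [hx, hy]⟩
  obtain ⟨N, hNm⟩ := (Set.toFinite S).exists_maximal hSne
  obtain ⟨hNn, hNc⟩ := hNm.prop
  have hself : ∀ x, (∀ y ∈ N, x * y = y * x) → x ∈ N := by
    intro x hx
    by_contra hxN
    have hle : N ≤ Subgroup.centralizer (N : Set P) := by
      intro y hy
      rw [Subgroup.mem_centralizer_iff]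
      intro t ht
      exact hNc t ht y hy
    have hxC : x ∈ Subgroup.centralizer (N : Set P) := by
      rw [Subgroup.mem_centralizer_iff]
      intro t ht
      exact (hx t ht).symm
    have hlt : N < Subgroup.centralizer (N : Set P) :=
      lt_of_le_of_ne hle (fun e => hxN (e ▸ hxC))
    obtain ⟨b, hbC, hbN, hb⟩ := pgroup_next hP N (Subgroup.centralizer (N : Set P)) hlt
    rw [Subgroup.mem_centralizer_iff] at hbC
    have hnorm : (N ⊔ Subgroup.zpowers b).Normal := by
      constructor
      intro n hn g
      have : N ⊔ Subgroup.zpowers b ≤ (N ⊔ Subgroup.zpowers b).comap (MulAut.conj g).toMonoidHom := by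
        apply sup_le
        · intro y hy
          rw [Subgroup.mem_comap]
          exact Subgroup.mem_sup_left (hNn.conj_mem y hy g)
        · rw [Subgroup.zpowers_le, Subgroup.mem_comap]
          have e : (MulAut.conj g).toMonoidHom b = (g * b * g⁻¹ * b⁻¹) * b := by simp
          rw [e]
          exact Subgroup.mul_mem _ (Subgroup.mem_sup_left (hb g))
            (Subgroup.mem_sup_right (Subgroup.mem_zpowers b))
      exact this hn
    have hbb : ∀ x ∈ N ⊔ Subgroup.zpowers b, ∀ y ∈ N, x * y = y * x := by
      intro x hx y hy
      have : N ⊔ Subgroup.zpowers b ≤ Subgroup.centralizer {y} := by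
        apply sup_le
        · intro t ht
          rw [Subgroup.mem_centralizer_singleton_iff]
          exact hNc t ht y hy
        · rw [Subgroup.zpowers_le, Subgroup.mem_centralizer_singleton_iff]
          exact (hbC y hy).symm
      exact Subgroup.mem_centralizer_singleton_iff.1 (this hx)
    have hmem : N ⊔ Subgroup.zpowers b ∈ S := by
      refine ⟨hnorm, ?_⟩
      intro x hx y hy
      have : N ⊔ Subgroup.zpowers b ≤ Subgroup.centralizer {x} := by
        apply sup_le
        · intro t ht
          rw [Subgroup.mem_centralizer_singleton_iff]
          exact (hbb x hx t ht).symm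
        · rw [Subgroup.zpowers_le, Subgroup.mem_centralizer_singleton_iff]
          have h2 : N ⊔ Subgroup.zpowers b ≤ Subgroup.centralizer {b} := by
            apply sup_le
            · intro t ht
              rw [Subgroup.mem_centralizer_singleton_iff]
              exact hbC t ht
            · rw [Subgroup.zpowers_le, Subgroup.mem_centralizer_singleton_iff]
          exact (Subgroup.mem_centralizer_singleton_iff.1 (h2 hx)).symm
      exact (Subgroup.mem_centralizer_singleton_iff.1 (this hy)).symm
    exact hbN (hNm.le_of_ge hmem le_sup_left (Subgroup.mem_sup_right (Subgroup.mem_zpowers b)))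
  obtain ⟨z, hzc, hz1, hzp⟩ : ∃ z : P, z ∈ Subgroup.center P ∧ z ≠ 1 ∧ z ^ p = 1 := by
    haveI := hP.center_nontrivial
    obtain ⟨⟨s, hs⟩, hs1⟩ := exists_ne (1 : Subgroup.center P)
    have hs1' : s ∉ (⊥ : Subgroup P) := by
      rw [Subgroup.mem_bot]
      intro e
      exact hs1 (Subtype.ext e)
    obtain ⟨k, hk1, hk2⟩ := pstep hP ⊥ hs1'
    exact ⟨s ^ p ^ k, Subgroup.pow_mem _ hs _, fun e => hk1 (by rw [e]; exact Subgroup.one_mem _),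
      by simpa using hk2⟩
  have hzc' : ∀ g, g * z = z * g := Subgroup.mem_center_iff.1 hzc
  have hzN : z ∈ N := hself z (fun y _ => (hzc' y).symm)
  have hu : ∀ x ∈ N, x ^ p = 1 → x ∈ Subgroup.zpowers z := by
    let B : Subgroup P :=
      { carrier := {x | x ∈ N ∧ x ^ p = 1}
        one_mem' := ⟨N.one_mem, one_pow _⟩
        mul_mem' := by
          rintro a b ⟨ha, ha'⟩ ⟨hb, hb'⟩
          refine ⟨N.mul_mem ha hb, ?_⟩
          rw [(show Commute a b from hNc a ha b hb).mul_pow, ha', hb', one_mul]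
        inv_mem' := by
          rintro a ⟨ha, ha'⟩
          exact ⟨N.inv_mem ha, by rw [inv_pow, ha', inv_one]⟩ }
    haveI : B.Normal := ⟨by
      rintro n ⟨hn, hn'⟩ g
      exact ⟨hNn.conj_mem n hn g, by rw [conj_pow, hn']; simp⟩⟩
    haveI : (Subgroup.zpowers z).Normal := ⟨by
      intro n hn g
      obtain ⟨k, rfl⟩ := hn
      have : Commute g (z ^ k) := (show Commute g z from hzc' g).zpow_right k
      simp only
      rw [this.eq, mul_inv_cancel_right]
      exact Subgroup.zpow_mem _ (Subgroup.mem_zpowers z) _⟩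
    intro x hx hxp
    by_contra hxz
    have hle : Subgroup.zpowers z ≤ B := by
      rw [Subgroup.zpowers_le]; exact ⟨hzN, hzp⟩
    have hlt : Subgroup.zpowers z < B :=
      lt_of_le_of_ne hle (fun e => hxz (by rw [e]; exact ⟨hx, hxp⟩))
    obtain ⟨b, ⟨hbN, hbp⟩, hbz, hb⟩ := pgroup_next hP (Subgroup.zpowers z) B hlt
    refine T2_noE h b z hzp hbp hz1 hbz hzc' ?_
    intro g
    have e : g * b * g⁻¹ = (g * b * g⁻¹ * b⁻¹) * b := by simp
    rw [e]
    exact Subgroup.mul_mem _ (Subgroup.mem_sup_left (hb g))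
      (Subgroup.mem_sup_right (Subgroup.mem_zpowers b))
  obtain ⟨c, hcN, rfl⟩ := cyc_of_unique hP N hNc z hzN hzp hz1 hu
  refine ⟨c, z, hNn, ?_, hz1, hzp, hzN, hzc', hu⟩
  intro x hx
  apply hself
  rintro y ⟨k, rfl⟩
  exact (show Commute x c from hx).zpow_right k
theorem expo_zpow {P : Type u} [Group P] {c g : P} {r : ℤ} (h : g * c = c ^ r * g) (k : ℤ) :
    g * c ^ k = c ^ (r * k) * g := by
  have h1 : g * c * g⁻¹ = c ^ r := by rw [h, mul_inv_cancel_right]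
  have h2 : g * c ^ k * g⁻¹ = c ^ (r * k) := by
    rw [← conj_zpow, h1, zpow_mul]
  rw [← h2, inv_mul_cancel_right]

theorem expo_mul {P : Type u} [Group P] {c g g' : P} {r s : ℤ} (h : g * c = c ^ r * g)
    (h' : g' * c = c ^ s * g') : (g * g') * c = c ^ (r * s) * (g * g') := by
  rw [mul_assoc, h', ← mul_assoc, expo_zpow h, mul_assoc]

theorem expo_pow {P : Type u} [Group P] {c g : P} {r : ℤ} (h : g * c = c ^ r * g) (k : ℕ) :
    g ^ k * c = c ^ (r ^ k) * g ^ k := by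
  induction k with
  | zero => simp
  | succ k ih => rw [pow_succ g, pow_succ r]; exact expo_mul ih h

theorem noG {P : Type u} [Group P] [Finite P] (h : T2 P) {p : ℕ}
    [hp : Fact p.Prime] (hP : IsPGroup p P) (c z : P) [hN : (Subgroup.zpowers c).Normal]
    (hself : ∀ x, x * c = c * x → x ∈ Subgroup.zpowers c)
    (hz1 : z ≠ 1) (hzp : z ^ p = 1) (hzc : ∀ g, g * z = z * g)
    (hu : ∀ x ∈ Subgroup.zpowers c, x ^ p = 1 → x ∈ Subgroup.zpowers z)
    (n : ℕ) (hn : orderOf c = p ^ n) (g : P) (hg : g ∉ Subgroup.zpowers c) (r : ℤ)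
    (hr : g * c = c ^ r * g) (hd : (p : ℤ) ^ n ∣ p * (r - 1)) (hpn : p ≠ 2 ∨ 3 ≤ n) : False := by
  have hcn : ∀ i : ℤ, c ^ i = 1 ↔ (p : ℤ) ^ n ∣ i := by
    intro i; rw [← orderOf_dvd_iff_zpow_eq_one, hn]; push_cast; rfl
  obtain ⟨w, hw⟩ : ∃ w, w = c ^ (r - 1) := ⟨_, rfl⟩
  have hwN : w ∈ Subgroup.zpowers c := hw ▸ Subgroup.zpow_mem _ (Subgroup.mem_zpowers c) _
  have hwp : w ^ p = 1 := by
    rw [hw, ← zpow_natCast, ← zpow_mul, hcn, mul_comm]; exact hd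
  have hcw : c ^ r = c * w := by rw [hw, ← zpow_one_add]; congr 1; ring
  have hgc : g * c = c * w * g := by rw [hr, hcw]
  have hw1 : w ≠ 1 := by
    intro e
    exact hg (hself g (by rw [hgc, e, mul_one]))
  have hwz := hu w hwN hwp
  have hzw : Subgroup.zpowers w = Subgroup.zpowers z := by
    by_contra hne
    refine hw1 (prime_inf (p := p) (M := Subgroup.zpowers w) (N := Subgroup.zpowers z) ?_ ?_ hne
      (Subgroup.mem_zpowers w) hwz)
    · rw [Nat.card_zpowers]; exact orderOf_eq_prime hwp hw1
    · rw [Nat.card_zpowers]; exact orderOf_eq_prime hzp hz1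
  have hwc : ∀ x, x * w = w * x := by
    intro x
    obtain ⟨k, rfl⟩ := hwz
    exact (show Commute x z from hzc x).zpow_right k
  rw [← hzw] at hu
  by_cases h2 : p = 2
  · have h3 : 3 ≤ n := hpn.resolve_left (fun e => e h2)
    have h4 : (4 : ℤ) ∣ r - 1 := by
      obtain ⟨m, rfl⟩ := Nat.exists_eq_add_of_le h3
      subst h2
      have : ((2 : ℕ) : ℤ) * 4 ∣ ((2 : ℕ) : ℤ) * (r - 1) := by
        refine dvd_trans ⟨2 ^ m, ?_⟩ hd
        push_cast; rw [pow_add]; norm_num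
      exact Int.dvd_of_mul_dvd_mul_left (by norm_num) this
    obtain ⟨e, he⟩ := h4
    refine claim1 h hP c g w hself hwN hwc hwp hgc hg hu e ?_
    subst h2
    rw [hw, he]
    norm_num
  · refine claim1 h hP c g w hself hwN hwc hwp hgc hg hu 0 ?_
    have : p ∣ p.choose 2 := hp.out.dvd_choose_self (by norm_num)
      (lt_of_le_of_ne hp.out.two_le (Ne.symm h2))
    obtain ⟨k, hk⟩ := this
    rw [hk, pow_mul, hwp]; simp

theorem noOdd {P : Type u} [Group P] [Finite P] (h : T2 P) {p : ℕ}
    [hp : Fact p.Prime] (hP : IsPGroup p P) (c z : P) [hN : (Subgroup.zpowers c).Normal]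
    (hself : ∀ x, x * c = c * x → x ∈ Subgroup.zpowers c)
    (hz1 : z ≠ 1) (hzp : z ^ p = 1) (hzN : z ∈ Subgroup.zpowers c) (hzc : ∀ g, g * z = z * g)
    (hu : ∀ x ∈ Subgroup.zpowers c, x ^ p = 1 → x ∈ Subgroup.zpowers z)
    (hp2 : p ≠ 2) (x : P) : x ∈ Subgroup.zpowers c := by
  obtain ⟨n, hn⟩ := IsPGroup.iff_orderOf.1 hP c
  have hcn : ∀ i : ℤ, c ^ i = 1 ↔ (p : ℤ) ^ n ∣ i := by
    intro i; rw [← orderOf_dvd_iff_zpow_eq_one, hn]; push_cast; rfl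
  by_contra hx
  obtain ⟨k, hk1, hk2⟩ := pstep hP _ hx
  generalize x ^ p ^ k = g at hk1 hk2
  obtain ⟨r, hr⟩ := hN.conj_mem c (Subgroup.mem_zpowers c) g
  simp only at hr
  have hr' : g * c = c ^ r * g := by rw [hr, inv_mul_cancel_right]
  have h1 := expo_pow hr' p
  have h2 : g ^ p * c = c * g ^ p := by
    obtain ⟨i, hi⟩ := hk2
    simp only at hi
    rw [← hi]; group
  rw [h2] at h1
  have h3 : c ^ (r ^ p - 1) = 1 := by
    rw [zpow_sub_one, ← mul_right_cancel h1, mul_inv_cancel]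
  rw [hcn] at h3
  have hn0 : n ≠ 0 := by
    rintro rfl
    rw [pow_zero, orderOf_eq_one_iff] at hn
    subst hn
    simp at hzN
    exact hz1 hzN
  have h4 : (p : ℤ) ∣ r ^ p - r := by
    rw [← ZMod.intCast_zmod_eq_zero_iff_dvd]
    push_cast
    rw [ZMod.pow_card, sub_self]
  have h5 : (p : ℤ) ∣ r - 1 := by
    have := dvd_sub ((dvd_pow_self (p : ℤ) hn0).trans h3) h4
    simpa using this
  have hpp : Prime (p : ℤ) := Nat.prime_iff_prime_int.1 hp.out
  have h6 : ¬ (p : ℤ) ∣ r := by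
    intro h6
    have := dvd_sub h6 h5
    simp only [sub_sub_cancel] at this
    exact hpp.not_isUnit (isUnit_of_dvd_one this)
  have h7 := Int.emultiplicity_pow_sub_pow hp.out (hp.out.odd_of_ne_two hp2) h5 h6 p
  refine noG h hP c z hself hz1 hzp hzc hu n hn g hk1 r hr' ?_ (Or.inl hp2)
  rw [pow_dvd_iff_le_emultiplicity, emultiplicity_mul hpp, add_comm]
  rw [one_pow] at h7
  rw [pow_dvd_iff_le_emultiplicity, h7] at h3
  convert h3 using 2
  exact Int.natCast_emultiplicity p p
theorem quatIso {P : Type u} [Group P] [Finite P] (c g : P) (m : ℕ)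
    (hc : orderOf c = 2 * 2 ^ m) (hg : g ∉ Subgroup.zpowers c)
    (hg2 : g * g = c ^ ((2 : ℤ) ^ m)) (hgc : ∀ k : ℤ, g * c ^ k = c ^ (-k) * g)
    (hcov : ∀ x, x ∉ Subgroup.zpowers c → ∃ y ∈ Subgroup.zpowers c, x = g * y) :
    Nonempty (P ≃* QuaternionGroup (2 ^ m)) := by
  have hcn : ∀ i : ℤ, c ^ i = 1 ↔ ((2 * 2 ^ m : ℕ) : ℤ) ∣ i := by
    intro i; rw [← orderOf_dvd_iff_zpow_eq_one, hc]
  have hceq : ∀ i j : ℤ, ((i : ZMod (2 * 2 ^ m)) = (j : ZMod (2 * 2 ^ m))) ↔ c ^ i = c ^ j := by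
    intro i j
    rw [← sub_eq_zero, ← Int.cast_sub, ZMod.intCast_zmod_eq_zero_iff_dvd, ← hcn, zpow_sub,
      mul_inv_eq_one]
  have hcast : ∀ i : ZMod (2 * 2 ^ m), ∃ k : ℤ, (k : ZMod (2 * 2 ^ m)) = i :=
    ZMod.intCast_surjective
  let φ : ZMod (2 * 2 ^ m) → P := fun i => c ^ (Classical.choose (hcast i))
  have hφ : ∀ k : ℤ, φ (k : ZMod (2 * 2 ^ m)) = c ^ k := by
    intro k
    exact (hceq _ _).1 (Classical.choose_spec (hcast (k : ZMod (2 * 2 ^ m))))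
  let f : QuaternionGroup (2 ^ m) → P := fun q => match q with
    | .a i => φ i
    | .xa i => g * φ i
  have hf1 : ∀ k : ℤ, f (.a k) = c ^ k := hφ
  have hf2 : ∀ k : ℤ, f (.xa k) = g * c ^ k := fun k => by
    change g * φ _ = _; rw [hφ]
  have hmul : ∀ x y, f (x * y) = f x * f y := by
    rintro (i | i) (j | j) <;> obtain ⟨i, rfl⟩ := hcast i <;> obtain ⟨j, rfl⟩ := hcast j
    · rw [QuaternionGroup.a_mul_a, ← Int.cast_add, hf1, hf1, hf1, zpow_add]
    · rw [QuaternionGroup.a_mul_xa, ← Int.cast_sub, hf1, hf2, hf2, hgc, hgc,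
        ← mul_assoc, ← zpow_add]
      congr 2; ring
    · rw [QuaternionGroup.xa_mul_a, ← Int.cast_add, hf1, hf2, hf2, mul_assoc, zpow_add]
    · rw [QuaternionGroup.xa_mul_xa, hf2, hf2]
      have : ((2 ^ m : ℕ) : ZMod (2 * 2 ^ m)) + (j : ZMod (2 * 2 ^ m)) - (i : ZMod (2 * 2 ^ m)) = ((2 ^ m + j - i : ℤ) : ZMod (2 * 2 ^ m)) := by
        push_cast; rfl
      rw [this, hf1, hgc i, mul_assoc, ← mul_assoc g g, hg2, ← zpow_add, ← zpow_add]
      congr 1; ring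
  have hinj : ∀ x, f x = 1 → x = 1 := by
    rintro (i | i) hx <;> obtain ⟨i, rfl⟩ := hcast i
    · rw [hf1, ← zpow_zero c, ← hceq] at hx
      rw [hx]; simp
    · rw [hf2] at hx
      exfalso
      apply hg
      rw [mul_eq_one_iff_eq_inv] at hx
      rw [hx]
      exact Subgroup.inv_mem _ (Subgroup.zpow_mem _ (Subgroup.mem_zpowers c) _)
  let F : QuaternionGroup (2 ^ m) →* P := MonoidHom.mk' f hmul
  have hFi : Function.Injective F := (injective_iff_map_eq_one F).2 hinj
  have hFs : Function.Surjective F := by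
    intro x
    by_cases hx : x ∈ Subgroup.zpowers c
    · obtain ⟨k, rfl⟩ := hx
      exact ⟨.a k, hf1 k⟩
    · obtain ⟨y, ⟨k, rfl⟩, rfl⟩ := hcov x hx
      exact ⟨.xa k, hf2 k⟩
  exact ⟨(MulEquiv.ofBijective F ⟨hFi, hFs⟩).symm⟩

theorem caseTwo {P : Type u} [Group P] [Finite P] (h : T2 P)
    (hP : IsPGroup 2 P) (c z : P) [hN : (Subgroup.zpowers c).Normal]
    (hself : ∀ x, x * c = c * x → x ∈ Subgroup.zpowers c)
    (hz1 : z ≠ 1) (hzp : z ^ 2 = 1) (hzN : z ∈ Subgroup.zpowers c) (hzc : ∀ g, g * z = z * g)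
    (hu : ∀ x ∈ Subgroup.zpowers c, x ^ 2 = 1 → x ∈ Subgroup.zpowers z)
    (g : P) (hg : g ∉ Subgroup.zpowers c) : IsGeneralizedQuaternion P := by
  obtain ⟨n, hn⟩ := IsPGroup.iff_orderOf.1 hP c
  have hcn : ∀ i : ℤ, c ^ i = 1 ↔ (2 : ℤ) ^ n ∣ i := by
    intro i; rw [← orderOf_dvd_iff_zpow_eq_one, hn]; push_cast; rfl
  have hceq : ∀ i j : ℤ, c ^ i = c ^ j ↔ (2 : ℤ) ^ n ∣ i - j := by
    intro i j
    rw [← hcn, zpow_sub, mul_inv_eq_one]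
  have hn0 : n ≠ 0 := by
    rintro rfl
    rw [pow_zero, orderOf_eq_one_iff] at hn
    subst hn
    simp at hzN
    exact hz1 hzN
  have hcN := Subgroup.mem_zpowers c
  have hex : ∀ g : P, ∃ r : ℤ, g * c = c ^ r * g := by
    intro g
    obtain ⟨r, hr⟩ := hN.conj_mem c hcN g
    simp only at hr
    exact ⟨r, by rw [hr, inv_mul_cancel_right]⟩
  have hodd : ∀ (g : P) (r : ℤ), g * c = c ^ r * g → r % 2 = 1 := by
    intro g r hr
    by_contra hne
    obtain ⟨s, hs⟩ : (2 : ℤ) ∣ r := by omega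
    obtain ⟨m, rfl⟩ := Nat.exists_eq_succ_of_ne_zero hn0
    have h1 := expo_zpow hr ((2 : ℤ) ^ m)
    have h2 : c ^ (r * (2 : ℤ) ^ m) = 1 := by
      rw [hcn, hs]; exact ⟨s, by rw [Nat.succ_eq_add_one, pow_succ]; ring⟩
    rw [h2, one_mul, mul_eq_left, hcn] at h1
    have h3 := Int.le_of_dvd (by positivity) h1
    rw [Nat.succ_eq_add_one, pow_succ] at h3
    have : (0 : ℤ) < 2 ^ m := by positivity
    omega
  -- squares in N force exponent 3 mod 4
  have key1 : ∀ (g : P) (r : ℤ), g ∉ Subgroup.zpowers c → g ^ 2 ∈ Subgroup.zpowers c →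
      g * c = c ^ r * g → r % 4 = 3 := by
    intro g r hg hg2 hr
    by_contra hne
    have ho := hodd g r hr
    have h4 : r % 4 = 1 := by omega
    obtain ⟨s, hs⟩ : ∃ s, r = 4 * s + 1 := ⟨r / 4, by omega⟩
    by_cases h3 : 3 ≤ n
    · refine noG h hP c z hself hz1 hzp hzc hu n hn g hg r hr ?_ (Or.inr h3)
      have h1 := expo_pow hr 2
      have h2 : g ^ 2 * c = c * g ^ 2 := by
        obtain ⟨i, hi⟩ := hg2
        simp only at hi
        rw [← hi]; group
      rw [h2] at h1
      have h5 := mul_right_cancel h1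
      nth_rewrite 1 [← zpow_one c] at h5
      rw [hceq] at h5
      have hcop : IsCoprime ((2 : ℤ) ^ n) (2 * s + 1) :=
        IsCoprime.pow_left ⟨-s, 1, by ring⟩
      push_cast
      refine hcop.dvd_of_dvd_mul_right ?_
      rw [dvd_sub_comm] at h5
      convert h5 using 1
      rw [hs]; ring
    · apply hg
      apply hself
      rw [hr]
      congr 1
      nth_rewrite 2 [← zpow_one c]
      rw [hceq]
      refine dvd_trans (pow_dvd_pow (2 : ℤ) (show n ≤ 2 by omega)) ⟨s, ?_⟩
      rw [hs]; ring
  have key2 : ∀ g : P, g ∉ Subgroup.zpowers c → g ^ 2 ∈ Subgroup.zpowers c := by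
    intro g _
    by_contra h2
    obtain ⟨k, hk1, hk2⟩ := pstep hP _ h2
    obtain ⟨r, hr⟩ := hex g
    have h3 := key1 _ _ hk1 hk2 (expo_pow (expo_pow hr 2) (2 ^ k))
    have ho := hodd g r hr
    have h4 : (r ^ 2) ≡ 1 [ZMOD 4] := by
      obtain ⟨s, hs⟩ : ∃ s, r = 2 * s + 1 := ⟨r / 2, by omega⟩
      refine (Int.modEq_iff_dvd.2 ⟨s * s + s, ?_⟩).symm
      rw [hs]; ring
    have h5 := h4.pow (2 ^ k)
    rw [one_pow] at h5
    have h6 : (r ^ 2) ^ 2 ^ k % 4 = 1 := h5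
    omega
  have key3 : ∀ (g : P) (r : ℤ), g ∉ Subgroup.zpowers c → g * c = c ^ r * g → r % 4 = 3 :=
    fun g r hg hr => key1 g r hg (key2 g hg) hr
  have key4 : ∀ g g' : P, g ∉ Subgroup.zpowers c → g' ∉ Subgroup.zpowers c →
      g * g' ∈ Subgroup.zpowers c := by
    intro g g' hg hg'
    by_contra hgg
    obtain ⟨r, hr⟩ := hex g
    obtain ⟨s, hs⟩ := hex g'
    have h1 := key3 g r hg hr
    have h2 := key3 g' s hg' hs
    have h3 := key3 _ _ hgg (expo_mul hr hs)
    rw [Int.mul_emod, h1, h2] at h3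
    omega
  have hcov : ∀ g : P, g ∉ Subgroup.zpowers c → ∀ x, x ∉ Subgroup.zpowers c →
      ∃ y ∈ Subgroup.zpowers c, x = g * y := by
    intro g hg x hx
    refine ⟨g⁻¹ * x, key4 _ _ (fun hh => hg ?_) hx, by group⟩
    simpa using hh
  have hzz : ∀ x ∈ Subgroup.zpowers c, x ^ 2 = 1 → x ≠ 1 → x = z := by
    intro x hx hx2 hx1
    have := hu x hx hx2
    obtain ⟨k, rfl⟩ := this
    simp only at hx1 ⊢
    have hz2 : z ^ (2 : ℤ) = 1 := by exact_mod_cast hzp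
    rcases Int.emod_two_eq_zero_or_one k with hk | hk
    · exfalso; apply hx1
      obtain ⟨s, rfl⟩ : ∃ s, k = 2 * s := ⟨k / 2, by omega⟩
      rw [zpow_mul, hz2, one_zpow]
    · obtain ⟨s, rfl⟩ : ∃ s, k = 2 * s + 1 := ⟨k / 2, by omega⟩
      rw [zpow_add, zpow_mul, hz2, one_zpow, one_mul, zpow_one]
  have hsq : ∀ g : P, g ∉ Subgroup.zpowers c → g ^ 2 = z := by
    intro g hg
    have hg2N := key2 g hg
    refine hzz _ hg2N ?_ ?_
    · obtain ⟨i, hi⟩ := hg2N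
      simp only at hi
      obtain ⟨r, hr⟩ := hex g
      have h1 := expo_zpow hr i
      have h2 : g * c ^ i = c ^ i * g := by rw [hi, ← pow_succ, ← pow_succ']
      rw [h2] at h1
      have h3 := mul_right_cancel h1
      rw [hceq] at h3
      have h4 := key3 g r hg hr
      obtain ⟨s, hs⟩ : ∃ s, r = 4 * s + 3 := ⟨r / 4, by omega⟩
      have hcop : IsCoprime ((2 : ℤ) ^ n) (2 * s + 1) :=
        IsCoprime.pow_left ⟨-s, 1, by ring⟩
      rw [← hi, ← zpow_natCast, ← zpow_mul, hcn]
      refine hcop.dvd_of_dvd_mul_right ?_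
      rw [dvd_sub_comm] at h3
      convert h3 using 1
      rw [hs]; push_cast; ring
    · intro hg2
      have hmem : ∀ x ∈ Subgroup.zpowers g, x = 1 ∨ x = g := by
        rintro x ⟨k, rfl⟩
        simp only
        have hz2 : g ^ (2 : ℤ) = 1 := by exact_mod_cast hg2
        rcases Int.emod_two_eq_zero_or_one k with hk | hk
        · obtain ⟨s, rfl⟩ : ∃ s, k = 2 * s := ⟨k / 2, by omega⟩
          left; rw [zpow_mul, hz2, one_zpow]
        · obtain ⟨s, rfl⟩ : ∃ s, k = 2 * s + 1 := ⟨k / 2, by omega⟩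
          right; rw [zpow_add, zpow_mul, hz2, one_zpow, one_mul, zpow_one]
      have hg1 : g ≠ 1 := fun e => hg (e ▸ Subgroup.one_mem _)
      have hcore : (Subgroup.zpowers g).normalCore = ⊥ := by
        rw [eq_bot_iff]
        intro x hx
        rcases hmem x (Subgroup.normalCore_le _ hx) with e | e
        · exact e
        · exfalso
          subst e
          apply hg
          apply hself
          have h5 := (Subgroup.normalCore_normal (Subgroup.zpowers x)).conj_mem x hx c
          rcases hmem _ (Subgroup.normalCore_le _ h5) with e | e
          · exfalso; apply hg1
            simpa using e
          · nth_rewrite 1 [← e]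
            group
      obtain ⟨m, hm, a, ha, hd⟩ := T2_factor h (Subgroup.zpowers c) (Subgroup.zpowers g) (by
        intro x
        by_cases hx : x ∈ Subgroup.zpowers c
        · exact ⟨x, hx, 1, Subgroup.one_mem _, by simp⟩
        · exact ⟨x * g, key4 _ _ hx hg, g, Subgroup.mem_zpowers g, by
            rw [mul_assoc, ← pow_two, hg2, mul_one]⟩) (by rw [hcore]; simp) g
      rw [hcore, Subgroup.mem_bot] at ha
      rw [ha, mul_one] at hd
      exact hg (hd ▸ hm)
  have hinv : g * c = c ^ (-1 : ℤ) * g := by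
    obtain ⟨r, hr⟩ := hex g
    have h1 : c * g ∉ Subgroup.zpowers c := fun hh =>
      hg ((Subgroup.mul_mem_cancel_left _ hcN).1 hh)
    have h2 := hsq _ h1
    have h3 : (c * g) ^ 2 = c * c ^ r * g ^ 2 := by
      rw [pow_two, pow_two]
      calc c * g * (c * g) = c * (g * c) * g := by group
        _ = _ := by rw [hr]; group
    rw [h3, hsq g hg, mul_eq_right] at h2
    rw [hr]; congr 1
    rw [zpow_neg_one]
    exact eq_inv_of_mul_eq_one_right h2
  have hn2 : 2 ≤ n := by
    by_contra hlt
    apply hg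
    apply hself
    rw [hinv]
    congr 1
    nth_rewrite 2 [← zpow_one c]
    rw [hceq]
    exact dvd_trans (pow_dvd_pow (2 : ℤ) (show n ≤ 1 by omega)) (by norm_num)
  obtain ⟨m, rfl⟩ : ∃ m, n = m + 1 := ⟨n - 1, by omega⟩
  refine ⟨m, by omega, quatIso c g m (by rw [hn, pow_succ, mul_comm]) hg ?_ ?_ (hcov g hg)⟩
  · rw [← pow_two, hsq g hg]
    symm
    apply hzz _ (Subgroup.zpow_mem _ hcN _)
    · rw [← zpow_natCast, ← zpow_mul, hcn]; exact ⟨1, by rw [pow_succ]; push_cast; ring⟩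
    · intro h1
      rw [hcn] at h1
      have h3 := Int.le_of_dvd (by positivity) h1
      rw [pow_succ] at h3
      have : (0 : ℤ) < 2 ^ m := by positivity
      omega
  · intro k
    rw [expo_zpow hinv, neg_one_mul]

theorem mainP {P : Type u} [Group P] [Finite P] (h : T2 P) {p : ℕ} [hp : Fact p.Prime]
    (hP : IsPGroup p P) : IsCyclic P ∨ IsGeneralizedQuaternion P := by
  rcases subsingleton_or_nontrivial P with hs | hs
  · left; infer_instance
  obtain ⟨c, z, hN, hself, hz1, hzp, hzN, hzc, hu⟩ := structA h hP
  by_cases hall : ∀ x, x ∈ Subgroup.zpowers c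
  · exact Or.inl ⟨c, hall⟩
  · push Not at hall
    obtain ⟨g, hg⟩ := hall
    by_cases h2 : p = 2
    · subst h2
      exact Or.inr (caseTwo h hP c z hself hz1 hzp hzN hzc hu g hg)
    · exact absurd (noOdd h hP c z hself hz1 hzp hzN hzc hu h2 g) hg

theorem normal_sylow_of_totally_two_closed
    (G : Type*) [Group G] [Finite G] (h2c : IsTotally2Closed G)
    (p : ℕ) [Fact p.Prime] (P : Sylow p G) (hP : (P : Subgroup G).Normal) :
    IsCyclic ↥(P : Subgroup G) ∨ IsGeneralizedQuaternion ↥(P : Subgroup G) := by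
  have h := T2_of_isTotally2Closed G h2c
  obtain ⟨K, hK⟩ := Subgroup.exists_right_complement'_of_coprime (N := (P : Subgroup G))
    P.card_coprime_index
  have hPK : ∀ x ∈ (P : Subgroup G), x ∈ K → x = 1 := by
    intro x h1 h2
    have := hK.disjoint.le_bot (show x ∈ (P : Subgroup G) ⊓ K from ⟨h1, h2⟩)
    simpa using this
  have hcov : ∀ g : G, ∃ m ∈ (P : Subgroup G), ∃ a ∈ K, g = m * a := by
    intro g
    obtain ⟨⟨⟨m, hm⟩, ⟨a, ha⟩⟩, e⟩ := hK.2 g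
    exact ⟨m, hm, a, ha, e.symm⟩
  have hcore : (P : Subgroup G) ⊓ K.normalCore = ⊥ := by
    rw [eq_bot_iff]
    rintro x ⟨h1, h2⟩
    exact hPK x h1 (Subgroup.normalCore_le _ h2)
  have hKn : K.normalCore = K := by
    refine le_antisymm (Subgroup.normalCore_le _) ?_
    intro d hd
    obtain ⟨m, hm, a, ha, e⟩ := T2_factor h (P : Subgroup G) K hcov hcore d
    have : m ∈ K := by
      have : m = d * a⁻¹ := by rw [e]; group
      rw [this]
      exact K.mul_mem hd (K.inv_mem (Subgroup.normalCore_le _ ha))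
    rw [hPK m hm this, one_mul] at e
    rw [e]; exact ha
  haveI : K.Normal := by rw [← hKn]; infer_instance
  have hs : ∀ q : G ⧸ K, ∃ x ∈ (P : Subgroup G), QuotientGroup.mk' K x = q := by
    intro q
    obtain ⟨g, rfl⟩ := QuotientGroup.mk'_surjective K q
    obtain ⟨m, hm, a, ha, rfl⟩ := hcov g
    refine ⟨m, hm, ?_⟩
    rw [map_mul, (QuotientGroup.eq_one_iff a).2 ha |> (show QuotientGroup.mk' K a = 1 from ·), mul_one]
  have hi : ∀ x ∈ (P : Subgroup G), QuotientGroup.mk' K x = 1 → x = 1 := by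
    intro x hx e
    exact hPK x hx ((QuotientGroup.eq_one_iff x).1 e)
  have hQ : T2 (G ⧸ K) := T2_transfer h (QuotientGroup.mk' K) (P : Subgroup G) hs hi
  let f : ↥(P : Subgroup G) →* G ⧸ K := (QuotientGroup.mk' K).comp (P : Subgroup G).subtype
  have hf : Function.Bijective f := by
    constructor
    · rw [injective_iff_map_eq_one]
      rintro ⟨x, hx⟩ e
      exact Subtype.ext (hi x hx e)
    · intro q
      obtain ⟨x, hx, e⟩ := hs q
      exact ⟨⟨x, hx⟩, e⟩
  let E := MulEquiv.ofBijective f hf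
  have hpQ : IsPGroup p (G ⧸ K) := P.isPGroup'.of_surjective f hf.2
  rcases mainP hQ hpQ with hc | ⟨m, hm, ⟨e⟩⟩
  · left
    exact isCyclic_of_surjective E.symm E.symm.surjective
  · right
    exact ⟨m, hm, ⟨E.trans e⟩⟩
end

section
/- Let Ω be a finite set, p a prime, and G ≤ Sym(Ω) a transitive p-group. Then the 2-closure G^{(2),Ω} is a p-group. -/
theorem twoClosure_step {Ω : Type*} (G : Subgroup (Equiv.Perm Ω)) (M N : Subgroup G) [M.Normal]
    (hMN : ∀ n ∈ N, ∀ g : G, n * g * n⁻¹ * g⁻¹ ∈ M) (θ : Equiv.Perm Ω) (hθ : θ ∈ twoClosure G)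
    (n : G) (hn : n ∈ N) (α : Ω) (h : θ α = n • α) (k : ℕ) :
    ∃ m ∈ M, (θ ^ k) α = (m * n ^ k) • α := by
  induction k with
  | zero => exact ⟨1, M.one_mem, by simp⟩
  | succ k ih =>
    obtain ⟨m, hm, e⟩ := ih
    obtain ⟨g0, hg, e1, e2⟩ := hθ α ((m * n ^ k) • α)
    obtain ⟨g, rfl⟩ : ∃ g : G, (g : Equiv.Perm Ω) = g0 := ⟨⟨g0, hg⟩, rfl⟩
    have e1' : g • α = n • α := by rw [← h]; exact e1.symm
    have e2' : θ ((m * n ^ k) • α) = g • ((m * n ^ k) • α) := e2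
    refine ⟨(g * m * g⁻¹) * (n ^ k * g * (n ^ k)⁻¹ * g⁻¹)⁻¹, M.mul_mem (Subgroup.Normal.conj_mem inferInstance m hm g)
      (M.inv_mem (hMN _ (N.pow_mem hn k) g)), ?_⟩
    rw [pow_succ', Equiv.Perm.mul_apply, e, e2', pow_succ, ← mul_assoc, mul_smul _ n, ← e1',
      ← mul_smul, ← mul_smul]
    congr 1
    group

theorem twoClosure_of_transitive_pGroup
    {Ω : Type*} [Finite Ω] (p : ℕ) [Fact p.Prime]
    (G : Subgroup (Equiv.Perm Ω))
    (htr : MulAction.IsPretransitive G Ω)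
    (hp : IsPGroup p G) : IsPGroup p (twoClosure G) := by
  obtain ⟨j, hj⟩ := IsPGroup.iff_card.mp hp
  have hnil : Group.IsNilpotent G := hp.isNilpotent
  obtain ⟨c, hc⟩ := Subgroup.nilpotent_iff_lowerCentralSeries.mp hnil
  have key : ∀ i, ∀ θ ∈ twoClosure G, ∃ k, ∀ α : Ω,
      ∃ n ∈ Subgroup.lowerCentralSeries (⊤ : Subgroup G) i, (θ ^ p ^ k) α = n • α := by
    intro i
    induction i with
    | zero =>
      intro θ _
      refine ⟨0, fun α => ?_⟩
      obtain ⟨g, hg⟩ := htr.exists_smul_eq α ((θ ^ p ^ 0) α)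
      exact ⟨g, by simp, hg.symm⟩
    | succ i ih =>
      intro θ hθ
      obtain ⟨k, hk⟩ := ih θ hθ
      refine ⟨k + j, fun α => ?_⟩
      obtain ⟨n, hn, e⟩ := hk α
      obtain ⟨m, hm, e'⟩ := twoClosure_step G (Subgroup.lowerCentralSeries (⊤ : Subgroup G) (i + 1))
        (Subgroup.lowerCentralSeries (⊤ : Subgroup G) i)
        (fun n hn g => Subgroup.commutator_mem_commutator hn (Subgroup.mem_top g))
        (θ ^ p ^ k) (Subgroup.pow_mem _ hθ _) n hn α e (p ^ j)
      refine ⟨m, hm, ?_⟩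
      rw [pow_add, pow_mul, e', ← hj, pow_card_eq_one', mul_one]
  rintro ⟨θ, hθ⟩
  obtain ⟨k, hk⟩ := key c θ hθ
  refine ⟨k, Subtype.ext (Equiv.ext fun α => ?_)⟩
  obtain ⟨n, hn, e⟩ := hk α
  rw [hc, Subgroup.mem_bot] at hn
  subst hn
  simpa using e
end

section
/- Let Ω be a finite set, p a prime, and G ≤ Sym(Ω). Then G is a p-group if and only if the 2-closure G^{(2),Ω} is a p-group. -/
theorem twoClosure_aux {Ω : Type*} (N : ℕ)
    (G : Subgroup (Equiv.Perm Ω)) (hN : ∀ g : G, g ^ N = 1) (i : ℕ) :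
    ∀ φ ∈ twoClosure G,
      (∀ α : Ω, ∃ z ∈ Subgroup.upperCentralSeries G i, φ α = (z : Equiv.Perm Ω) α) →
      φ ^ (N ^ i) = 1 := by
  induction i with
  | zero =>
    intro φ _ h
    ext α
    obtain ⟨z, hz, e⟩ := h α
    have hz1 : z = 1 := by simpa using hz
    simp [e, hz1]
  | succ i ih =>
    intro φ hφ h
    rw [pow_succ', pow_mul]
    refine ih _ (Subgroup.pow_mem _ hφ _) fun α => ?_
    obtain ⟨z, hz, e⟩ := h α
    have key : ∀ k : ℕ, ∃ c ∈ Subgroup.upperCentralSeries G i,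
        (φ ^ k) α = ((c * z ^ k : G) : Equiv.Perm Ω) α := by
      intro k
      induction k with
      | zero => exact ⟨1, Subgroup.one_mem _, by simp⟩
      | succ k ihk =>
        obtain ⟨c, hc, ek⟩ := ihk
        obtain ⟨g, hg, g1, g2⟩ := hφ α (((c * z ^ k : G) : Equiv.Perm Ω) α)
        have hw : c * z ^ k ∈ Subgroup.upperCentralSeries G (i + 1) :=
          Subgroup.mul_mem _ (Subgroup.upperCentralSeries_mono G (Nat.le_succ i) hc)
            (Subgroup.pow_mem _ hz _)
        have hcomm := (Subgroup.mem_upperCentralSeries_succ_iff).1 hw ⟨g, hg⟩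
        refine ⟨_, Subgroup.mul_mem _ (Subgroup.inv_mem _ hcomm) hc, ?_⟩
        rw [pow_succ', Equiv.Perm.mul_apply, ek, g2]
        have hgz : g α = (z : Equiv.Perm Ω) α := by rw [← g1, e]
        have e1 : (((c * z ^ k * ⟨g, hg⟩ * (c * z ^ k)⁻¹ * (⟨g, hg⟩ : G)⁻¹)⁻¹ * c * z ^ (k + 1) : G)) =
          (⟨g, hg⟩ * (c * z ^ k) * (⟨g, hg⟩ : G)⁻¹) * z := by
          group
        rw [commutatorElement_def, e1]
        simp only [Subgroup.coe_mul, Equiv.Perm.mul_apply, ← hgz, Subgroup.coe_inv]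
        simp
    obtain ⟨c, hc, ec⟩ := key N
    exact ⟨c, hc, by rw [ec, hN, mul_one]⟩

theorem isPGroup_iff_twoClosure_isPGroup
    {Ω : Type*} [Finite Ω] (p : ℕ) [Fact p.Prime]
    (G : Subgroup (Equiv.Perm Ω)) :
    IsPGroup p G ↔ IsPGroup p (twoClosure G) := by
  constructor
  · intro hG
    obtain ⟨n, hn⟩ := IsPGroup.iff_card.1 hG
    have hnil : Group.IsNilpotent G := hG.isNilpotent
    obtain ⟨c, hc⟩ := hnil.nilpotent
    rintro ⟨θ, hθ⟩
    refine ⟨n * c, Subtype.ext ?_⟩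
    have := twoClosure_aux (p ^ n) G (fun g => by rw [← hn]; exact pow_card_eq_one') c θ hθ
      (fun α => by
        obtain ⟨h, hh, e, _⟩ := hθ α α
        exact ⟨⟨h, hh⟩, by rw [hc]; trivial, e⟩)
    simpa [pow_mul] using this
  · intro h
    exact h.to_le fun g hg α β => ⟨g, hg, rfl, rfl⟩
end

section
/- Let Ω be a finite set, let G ≤ Sym(Ω) satisfy G = G^{(2),Ω}, and let P be a Sylow p-subgroup of G for a prime p. Then P = P^{(2),Ω}. -/
theorem step_aux {Ω : Type*} [Finite Ω] (P : Subgroup (Equiv.Perm Ω)) (p : ℕ) [Fact p.Prime]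
    (hP : IsPGroup p P) (θ : Equiv.Perm Ω) (hθ : θ ∈ twoClosure P) (n : ℕ) (hn : n.Coprime p)
    (h1 : θ ^ n = 1) (α : Ω) (c : ℕ) : ∀ H : Subgroup (Equiv.Perm Ω), Nat.card H = c → H ≤ P →
    (∀ k ∈ P, k α = α → k ∈ H) → (∃ h ∈ H, θ α = h α) → θ α = α := by
  induction c using Nat.strong_induction_on with
  | _ c ih =>
  rintro H hc hHP hst ⟨h, hh, e⟩
  have hHp : IsPGroup p H := hP.to_le hHP
  have : Group.IsNilpotent H := hHp.isNilpotent
  by_cases hS : MulAction.stabilizer H α = ⊤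
  · have : (⟨h, hh⟩ : H) ∈ MulAction.stabilizer H α := by rw [hS]; trivial
    rw [e]
    exact this
  obtain ⟨M, hM, hSM⟩ := (eq_top_or_exists_le_coatom (MulAction.stabilizer H α)).resolve_left hS
  have hMn : M.Normal := Subgroup.NormalizerCondition.normal_of_coatom M
    Group.normalizerCondition_of_isNilpotent hM
  have hstM : ∀ k : H, k.1 α = α → k ∈ M := fun k hk => hSM hk
  set h' : H := ⟨h, hh⟩ with hh'
  have key : ∀ g : H, ∃ m ∈ M, θ (g.1 α) = (h' * g * m).1 α := by
    intro g
    obtain ⟨k, hk, k1, k2⟩ := hθ α (g.1 α)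
    have hs : (h⁻¹ * k) α = α := by
      rw [Equiv.Perm.mul_apply, ← k1, e]; simp
    have hsH : h⁻¹ * k ∈ H := hst _ (P.mul_mem (P.inv_mem (hHP hh)) hk) hs
    have hsM := hstM ⟨_, hsH⟩ hs
    refine ⟨_, hMn.conj_mem _ hsM g⁻¹, ?_⟩
    rw [k2]
    simp [hh']
  have pw : ∀ j : ℕ, ∃ m ∈ M, (θ ^ j) α = (h' ^ j * m).1 α := by
    intro j
    induction j with
    | zero => exact ⟨1, M.one_mem, by simp⟩
    | succ j ihj =>
      obtain ⟨m, hm, em⟩ := ihj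
      obtain ⟨m', hm', em'⟩ := key (h' ^ j * m)
      refine ⟨m * m', M.mul_mem hm hm', ?_⟩
      rw [pow_succ', Equiv.Perm.mul_apply, em, em', pow_succ']
      simp only [mul_assoc]
  obtain ⟨m, hm, em⟩ := pw n
  have hnM : h' ^ n ∈ M := by
    have : h' ^ n * m ∈ M := hstM _ (by rw [← em, h1]; rfl)
    exact (M.mul_mem_cancel_right hm).1 this
  obtain ⟨a, ha⟩ := hHp h'
  have hhM : h' ∈ M := by
    have hco : (n : ℤ).gcd ((p ^ a : ℕ) : ℤ) = 1 := by
      rw [Int.gcd_natCast_natCast]; exact hn.pow_right a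
    have hb := Int.gcd_eq_gcd_ab n ((p ^ a : ℕ) : ℤ)
    rw [hco] at hb
    have : h' = h' ^ (1 : ℤ) := by simp
    rw [this]
    have hb' : (1 : ℤ) = _ := hb
    rw [hb', zpow_add, zpow_mul, zpow_mul, zpow_natCast, zpow_natCast, ha, one_zpow, mul_one]
    exact M.zpow_mem hnM _
  refine ih (Nat.card (M.map H.subtype)) ?_ (M.map H.subtype) rfl ?_ ?_ ?_
  · rw [← hc, Subgroup.card_map_of_injective H.subtype_injective]
    refine lt_of_le_of_ne (Subgroup.card_le_card_group M) fun hE => hM.1 ?_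
    exact Subgroup.eq_top_of_card_eq M hE
  · exact (Subgroup.map_subtype_le M).trans hHP
  · intro k hk hka
    exact ⟨⟨k, hst k hk hka⟩, hstM _ hka, rfl⟩
  · exact ⟨h, ⟨h', hhM, rfl⟩, e⟩

theorem twoClosure_isPGroup {Ω : Type*} [Finite Ω] (P : Subgroup (Equiv.Perm Ω)) (p : ℕ)
    [Fact p.Prime] (hP : IsPGroup p P) : IsPGroup p (twoClosure P) := by
  rintro ⟨g, hg⟩
  obtain ⟨a, m, hm, e⟩ := Nat.exists_eq_pow_mul_and_not_dvd (orderOf_pos g).ne' p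
    (Fact.out : p.Prime).ne_one
  refine ⟨a, Subtype.ext ?_⟩
  ext α
  have hc : m.Coprime p := (((Fact.out : p.Prime).coprime_iff_not_dvd).2 hm).symm
  obtain ⟨k, hk, k1, -⟩ := (twoClosure P).pow_mem hg (p ^ a) α α
  exact step_aux P p hP (g ^ p ^ a) ((twoClosure P).pow_mem hg _) m hc
    (by rw [← pow_mul, ← e, pow_orderOf_eq_one]) α _ P rfl le_rfl (fun k hk _ => hk) ⟨k, hk, k1⟩

theorem sylow_of_two_closed_is_two_closed
    {Ω : Type*} [Finite Ω] (G : Subgroup (Equiv.Perm Ω))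
    (hG : twoClosure G = G) (p : ℕ) [Fact p.Prime] (P : Sylow p G) :
    twoClosure (Subgroup.map G.subtype (P : Subgroup G)) =
      Subgroup.map G.subtype (P : Subgroup G) := by
  set Q := Subgroup.map G.subtype (P : Subgroup G) with hQ
  have hQp : IsPGroup p Q := P.isPGroup'.map _
  have hle : Q ≤ twoClosure Q := fun x hx α β => ⟨x, hx, rfl, rfl⟩
  have hleG : twoClosure Q ≤ G := by
    intro x hx
    rw [← hG]
    intro α β
    obtain ⟨k, hk, k1⟩ := hx α β
    exact ⟨k, Subgroup.map_subtype_le _ hk, k1⟩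
  refine le_antisymm ?_ hle
  have hR : IsPGroup p ((twoClosure Q).subgroupOf G) :=
    (twoClosure_isPGroup Q p hQp).comap_of_injective G.subtype G.subtype_injective
  have hPR : (P : Subgroup G) ≤ (twoClosure Q).subgroupOf G := fun x hx =>
    hle ⟨x, hx, rfl⟩
  have := P.is_maximal' hR hPR
  intro x hx
  refine ⟨⟨x, hleG hx⟩, ?_, rfl⟩
  rw [SetLike.mem_coe, ← this]
  exact hx
end

section
/- Let Ω be a finite set, let p be a prime, and let G ≤ Sym(Ω) satisfy G = G^{(2),Ω}. Then O_p(G) = (O_p(G))^{(2),Ω}. -/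
lemma aux_prime_order {Ω : Type*} [Finite Ω] (p q : ℕ) [Fact p.Prime] [Fact q.Prime] (hpq : q ≠ p)
    (H : Subgroup (Equiv.Perm Ω)) (hH : IsPGroup p H) (θ : Equiv.Perm Ω)
    (hθ : θ ∈ twoClosure H) (hq : θ ^ q = 1) : θ = 1 := by
  classical
  have := Fintype.ofFinite Ω
  have step : ∀ n : ℕ, (∀ β : Ω, ∃ z ∈ Subgroup.upperCentralSeries H (n+1), θ β = z • β) →
      (∀ β : Ω, ∃ z ∈ Subgroup.upperCentralSeries H n, θ β = z • β) := by
    intro n hn β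
    let Z := Subgroup.upperCentralSeries H (n+1)
    let B : Set Ω := MulAction.orbit Z β
    have hB : ∀ x, x ∈ B → θ x ∈ B := by
      intro x hx
      obtain ⟨z, hz, e⟩ := hn x
      rw [e]
      exact (MulAction.mem_orbit_of_mem_orbit (⟨z, hz⟩ : Z) hx)
    have hB' : ∀ x, θ x ∈ B ↔ x ∈ B := by
      intro x
      refine ⟨fun hx => ?_, hB x⟩
      obtain ⟨z, hz, e⟩ := hn x
      rw [e] at hx
      have := MulAction.mem_orbit_of_mem_orbit (⟨z, hz⟩ : Z)⁻¹ hx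
      have e2 : (⟨z, hz⟩ : Z)⁻¹ • (z • x) = x := inv_smul_smul (⟨z, hz⟩ : Z) x
      rwa [e2] at this
    have hfix : ∃ a : B, θ.subtypePerm (p := (· ∈ B)) hB' a = a := by
      apply Equiv.Perm.exists_fixed_point_of_prime (p := q) (n := 1)
      · obtain ⟨k, hk⟩ := (hH.to_subgroup Z).card_orbit β
        rw [← Nat.card_eq_fintype_card]
        change ¬ q ∣ Nat.card (MulAction.orbit Z β)
        rw [hk]
        intro h
        exact hpq ((Nat.prime_dvd_prime_iff_eq Fact.out Fact.out).1
          ((Fact.out : q.Prime).dvd_of_dvd_pow h))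
      · rw [pow_one, Equiv.Perm.subtypePerm_pow]
        ext x
        simp [hq]
    obtain ⟨⟨α, hα⟩, hfix⟩ := hfix
    have hfix : θ α = α := congrArg Subtype.val hfix
    have : β ∈ MulAction.orbit Z α := MulAction.mem_orbit_symm.1 hα
    obtain ⟨⟨z, hz⟩, e⟩ := this
    have e : z • α = β := e
    obtain ⟨h, hhH, e1, e2⟩ := hθ α β
    let h' : H := ⟨h, hhH⟩
    have e1 : h' • α = α := by rw [← hfix]; rw [hfix]; exact e1.symm.trans hfix
    have hz' := (Subgroup.mem_upperCentralSeries_succ_iff.1 hz) h'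
    refine ⟨(z * h' * z⁻¹ * h'⁻¹)⁻¹, inv_mem hz', ?_⟩
    rw [e2]
    change h' • β = _
    rw [← e]
    have : α = h'⁻¹ • α := by rw [eq_inv_smul_iff, e1]
    simp only [smul_smul]
    conv_lhs => rw [this]
    simp only [smul_smul]
    congr 1
    group
  have : Group.IsNilpotent H := hH.isNilpotent
  obtain ⟨c, hc⟩ := this.nilpotent
  have h0 : ∀ n, n ≤ c → (∀ β : Ω, ∃ z ∈ Subgroup.upperCentralSeries H (c - n), θ β = z • β) := by
    intro n
    induction n with
    | zero =>
      intro _ β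
      obtain ⟨h, hh, e, _⟩ := hθ β β
      exact ⟨⟨h, hh⟩, by simp [hc], e⟩
    | succ n ih =>
      intro hn
      apply step
      have : c - (n+1) + 1 = c - n := by omega
      rw [this]
      exact ih (by omega)
  ext β
  obtain ⟨z, hz, e⟩ := h0 c le_rfl β
  simp at hz
  simpa [hz] using e

lemma aux_pgroup {Ω : Type*} [Finite Ω] (p : ℕ) [Fact p.Prime]
    (H : Subgroup (Equiv.Perm Ω)) (hH : IsPGroup p H) : IsPGroup p (twoClosure H) := by
  rw [IsPGroup.iff_card]
  refine ⟨_, Nat.eq_prime_pow_of_unique_prime_dvd Nat.card_pos.ne' ?_⟩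
  intro q hq hd
  by_contra hne
  have : Fact q.Prime := ⟨hq⟩
  obtain ⟨x, hx⟩ := exists_prime_orderOf_dvd_card' q hd
  have h1 : (x : Equiv.Perm Ω) ^ q = 1 := by
    have := pow_orderOf_eq_one x
    rw [hx] at this
    exact_mod_cast congrArg Subtype.val this
  have := aux_prime_order p q hne H hH x x.2 h1
  have : x = 1 := Subtype.ext this
  rw [this, orderOf_one] at hx
  exact hq.one_lt.ne hx

theorem pCore_of_two_closed_is_two_closed
    {Ω : Type*} [Finite Ω] (p : ℕ) [Fact p.Prime]
    (G : Subgroup (Equiv.Perm Ω)) (hG : twoClosure G = G) :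
    twoClosure (⨅ P : Sylow p G, Subgroup.map G.subtype (P : Subgroup G)) =
      ⨅ P : Sylow p G, Subgroup.map G.subtype (P : Subgroup G) := by
  set H : Subgroup (Equiv.Perm Ω) := ⨅ P : Sylow p G, Subgroup.map G.subtype (P : Subgroup G)
    with hHdef
  obtain ⟨P₀⟩ : Nonempty (Sylow p G) := inferInstance
  have hHP : H ≤ Subgroup.map G.subtype (P₀ : Subgroup G) := iInf_le _ P₀
  have hHG : H ≤ G := hHP.trans (Subgroup.map_subtype_le _)
  have hHp : IsPGroup p H := (P₀.2.map G.subtype).to_le hHP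
  have hK := aux_pgroup p H hHp
  have hKG : twoClosure H ≤ G := by
    intro x hx
    rw [← hG]
    intro α β
    obtain ⟨h, hh, e⟩ := hx α β
    exact ⟨h, hHG hh, e⟩
  have hconj : ∀ g : G, ∀ x ∈ H, (g : Equiv.Perm Ω) * x * (g : Equiv.Perm Ω)⁻¹ ∈ H := by
    intro g x hx
    rw [hHdef, Subgroup.mem_iInf]
    intro P
    have hx' := (Subgroup.mem_iInf.1 hx) (g⁻¹ • P)
    obtain ⟨y, hy, rfl⟩ := hx'
    refine ⟨g * y * g⁻¹, ?_, by simp⟩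
    have hy : y ∈ ((g⁻¹ • P : Sylow p G) : Subgroup G) := hy
    rw [Sylow.coe_subgroup_smul, Subgroup.mem_pointwise_smul_iff_inv_smul_mem] at hy
    have hy2 : g * y * g⁻¹ ∈ (P : Subgroup G) := by simpa [MulAut.smul_def] using hy
    exact hy2
  have hKconj : ∀ g : G, ∀ x ∈ twoClosure H,
      (g : Equiv.Perm Ω) * x * (g : Equiv.Perm Ω)⁻¹ ∈ twoClosure H := by
    intro g x hx α β
    obtain ⟨h, hh, e1, e2⟩ := hx ((g : Equiv.Perm Ω)⁻¹ α) ((g : Equiv.Perm Ω)⁻¹ β)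
    exact ⟨_, hconj g h hh, congrArg g.1 e1, congrArg g.1 e2⟩
  let N : Subgroup G := (twoClosure H).subgroupOf G
  have hNn : N.Normal := ⟨fun n hn g => by
    simpa [N, Subgroup.mem_subgroupOf] using hKconj g n hn⟩
  have hNp : IsPGroup p N := hK.comap_of_injective G.subtype G.subtype_injective
  apply le_antisymm
  · rw [hHdef]
    refine le_iInf fun P x hx => ?_
    have hs : IsPGroup p (N ⊔ (P : Subgroup G) : Subgroup G) := hNp.to_sup_of_normal_left P.2
    have := P.3 hs le_sup_right
    refine ⟨⟨x, hKG hx⟩, ?_, rfl⟩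
    have hxN : (⟨x, hKG hx⟩ : G) ∈ N := hx
    change _ ∈ (P : Subgroup G)
    rw [← this]
    exact Subgroup.mem_sup_left hxN
  · intro x hx α β
    exact ⟨x, hx, rfl, rfl⟩
end

section
/- Let Ω be a finite set and G ≤ Sym(Ω). Then G is nilpotent if and only if the 2-closure G^{(2),Ω} is nilpotent. -/
theorem aux_pow {G H Ω : Type*} [Group G] [Group H] [MulAction G Ω] (π : G →* H)
    (n : ℕ) (hn : ∀ x : H, x ^ n = 1) (θ : Equiv.Perm Ω)
    (hθ : ∀ a b : Ω, ∃ g : G, θ a = g • a ∧ θ b = g • b) (L L' : Subgroup H)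
    (hL' : L' ≤ L) (hc : ∀ x y : H, y ∈ L → x * y * x⁻¹ * y⁻¹ ∈ L')
    (h : ∀ a, ∃ g : G, π g ∈ L ∧ θ a = g • a) :
    ∀ a, ∃ g : G, π g ∈ L' ∧ (θ ^ n) a = g • a := by
  intro a
  obtain ⟨z, hz, hza⟩ := h a
  have key : ∀ m : ℕ, ∃ g : G, π g * (π z ^ m)⁻¹ ∈ L' ∧ (θ ^ m) a = g • a := by
    intro m
    induction m with
    | zero => exact ⟨1, by simp [L'.one_mem], by simp⟩
    | succ m ih =>
      obtain ⟨w, hw, hwa⟩ := ih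
      have hwL : π w ∈ L := by
        have := L.mul_mem (hL' hw) (L.pow_mem hz m)
        simpa using this
      obtain ⟨g, h1, h2⟩ := hθ a (w • a)
      refine ⟨g * w * g⁻¹ * w⁻¹ * w * z, ?_, ?_⟩
      · have := L'.mul_mem (hc (π g) (π w) hwL) hw
        convert this using 1
        simp only [map_mul, map_inv, pow_succ']
        group
      · rw [pow_succ', Equiv.Perm.mul_apply, hwa, h2, mul_smul _ z, ← hza, h1]
        simp only [← mul_smul]
        congr 1
        group
  obtain ⟨g, hg, e⟩ := key n
  exact ⟨g, by simpa [hn] using hg, e⟩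

theorem aux_nil {G H Ω : Type*} [Group G] [Group H] [Group.IsNilpotent H] [MulAction G Ω]
    (π : G →* H) (n : ℕ) (hn : ∀ x : H, x ^ n = 1) (θ : Equiv.Perm Ω)
    (K : Subgroup (Equiv.Perm Ω)) (hK : θ ∈ K)
    (hθ : ∀ θ ∈ K, ∀ a b : Ω, ∃ g : G, θ a = g • a ∧ θ b = g • b) :
    ∃ k : ℕ, ∀ a, ∃ g : G, π g = 1 ∧ (θ ^ (n ^ k)) a = g • a := by
  have key : ∀ j : ℕ, ∃ k : ℕ, ∀ a, ∃ g : G,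
      π g ∈ (⊤ : Subgroup H).lowerCentralSeries j ∧ (θ ^ (n ^ k)) a = g • a := by
    intro j
    induction j with
    | zero =>
      refine ⟨0, fun a => ?_⟩
      obtain ⟨g, hg, _⟩ := hθ θ hK a a
      exact ⟨g, by simp, by simpa using hg⟩
    | succ j ih =>
      obtain ⟨k, hk⟩ := ih
      refine ⟨k + 1, ?_⟩
      rw [pow_succ, pow_mul]
      refine aux_pow π n hn _ (hθ _ (K.pow_mem hK _)) _ _ ?_ ?_ hk
      · exact Subgroup.lowerCentralSeries_antitone _ (Nat.le_succ j)
      · intro x y hy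
        rw [Subgroup.lowerCentralSeries_succ, Subgroup.commutator_comm]
        exact Subgroup.commutator_mem_commutator (Subgroup.mem_top x) hy
  obtain ⟨j, hj⟩ := Subgroup.nilpotent_iff_lowerCentralSeries.mp ‹Group.IsNilpotent H›
  obtain ⟨k, hk⟩ := key j
  refine ⟨k, fun a => ?_⟩
  obtain ⟨g, hg, e⟩ := hk a
  rw [hj] at hg
  exact ⟨g, Subgroup.mem_bot.mp hg, e⟩

def auxM {G H Ω : Type*} [Group G] [Group H] [MulAction G Ω] (π : G →* H)
    (K : Subgroup (Equiv.Perm Ω)) : Subgroup K where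
  carrier := {θ | ∀ a, ∃ g : G, π g = 1 ∧ θ.1 a = g • a}
  one_mem' := fun a => ⟨1, by simp, by simp⟩
  mul_mem' := by
    intro x y hx hy a
    obtain ⟨g, hg, e⟩ := hy a
    obtain ⟨g', hg', e'⟩ := hx (y.1 a)
    refine ⟨g' * g, by simp [hg, hg'], ?_⟩
    rw [mul_smul, ← e, ← e']; rfl
  inv_mem' := by
    intro x hx a
    obtain ⟨g, hg, e⟩ := hx (x.1⁻¹ a)
    refine ⟨g⁻¹, by simp [hg], ?_⟩
    rw [eq_inv_smul_iff]
    simpa using e.symm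

theorem auxM_normal {G H Ω : Type*} [Group G] [Group H] [MulAction G Ω] (π : G →* H)
    (K : Subgroup (Equiv.Perm Ω))
    (hK : ∀ θ ∈ K, ∀ a b : Ω, ∃ g : G, θ a = g • a ∧ θ b = g • b) :
    (auxM π K).Normal := by
  refine ⟨fun x hx k a => ?_⟩
  obtain ⟨g, hg, e⟩ := hx (k.1⁻¹ a)
  obtain ⟨h, h1, h2⟩ := hK k.1 k.2 (k.1⁻¹ a) (g • (k.1⁻¹ a))
  refine ⟨h * g * h⁻¹, by simp [hg], ?_⟩
  have h3 : h⁻¹ • a = k.1⁻¹ a := by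
    rw [inv_smul_eq_iff, ← h1]; simp
  rw [mul_smul, h3, mul_smul, ← h2, ← e]; rfl

theorem aux_coprime {G : Type*} [Group G] (S : Subgroup G) (x : G) (m n : ℕ)
    (h : Nat.Coprime m n) (hm : x ^ m ∈ S) (hn : x ^ n ∈ S) : x ∈ S := by
  have h1 : x = (x ^ m) ^ (Nat.gcdA m n) * (x ^ n) ^ (Nat.gcdB m n) := by
    rw [← zpow_natCast, ← zpow_natCast, ← zpow_mul, ← zpow_mul, ← zpow_add,
      ← Nat.gcd_eq_gcd_ab, h.gcd_eq_one]
    simp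
  rw [h1]
  exact S.mul_mem (S.zpow_mem hm _) (S.zpow_mem hn _)

theorem aux_prod {ι : Type*} [Finite ι] {H : ι → Type*} [∀ i, Group (H i)] [∀ i, Finite (H i)]
    (hc : ∀ i j, i ≠ j → Nat.Coprime (Nat.card (H i)) (Nat.card (H j)))
    (S : Subgroup (∀ i, H i)) (x : ∀ i, H i) (hx : ∀ i, ∃ h ∈ S, h i = x i) : x ∈ S := by
  classical
  have := Fintype.ofFinite ι
  apply Subgroup.pi_mem_of_mulSingle_mem
  intro i
  obtain ⟨h, hS, hi⟩ := hx i
  apply aux_coprime S _ (∏ j ∈ Finset.univ.erase i, Nat.card (H j)) (Nat.card (H i))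
  · apply Nat.Coprime.prod_left
    intro j hj
    exact hc _ _ (Finset.ne_of_mem_erase hj)
  · have : Pi.mulSingle i (x i) ^ (∏ j ∈ Finset.univ.erase i, Nat.card (H j)) =
        h ^ (∏ j ∈ Finset.univ.erase i, Nat.card (H j)) := by
      funext j
      by_cases hj : j = i
      · subst hj; simp [hi]
      · have hd : Nat.card (H j) ∣ (∏ j ∈ Finset.univ.erase i, Nat.card (H j)) :=
          Finset.dvd_prod_of_mem (fun j => Nat.card (H j)) (by simp [hj])
        obtain ⟨c, hc'⟩ := hd
        rw [Pi.pow_apply, Pi.pow_apply, hc', pow_mul, pow_mul, pow_card_eq_one', pow_card_eq_one']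
    rw [this]
    exact S.pow_mem hS _
  · rw [← Pi.mulSingle_pow, pow_card_eq_one', Pi.mulSingle_one]
    exact S.one_mem

theorem aux_main {Ω : Type*} [Finite Ω] (G : Subgroup (Equiv.Perm Ω))
    {ι : Type*} [Finite ι] {H : ι → Type*} [∀ i, Group (H i)] [∀ i, Finite (H i)]
    (p : ι → ℕ) (hp : ∀ i, (p i).Prime) (k : ι → ℕ) (hk : ∀ i, Nat.card (H i) = p i ^ k i)
    (hinj : Function.Injective p) (e : (∀ i, H i) ≃* G) :
    Group.IsNilpotent (twoClosure G) := by
  let π : ∀ i, G →* H i := fun i => (Pi.evalMonoidHom H i).comp e.symm.toMonoidHom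
  have hK : ∀ θ ∈ twoClosure G, ∀ a b : Ω, ∃ g : G, θ a = g • a ∧ θ b = g • b := by
    intro θ hθ a b
    obtain ⟨g, hg, h1, h2⟩ := hθ a b
    exact ⟨⟨g, hg⟩, h1, h2⟩
  have : ∀ i, (auxM (π i) (twoClosure G)).Normal := fun i => auxM_normal _ _ hK
  have hnil : ∀ i, Group.IsNilpotent (twoClosure G ⧸ auxM (π i) (twoClosure G)) := by
    intro i
    have : Fact (p i).Prime := ⟨hp i⟩
    have : Group.IsNilpotent (H i) := (IsPGroup.of_card (hk i)).isNilpotent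
    apply IsPGroup.isNilpotent (p := p i)
    intro x
    obtain ⟨θ, rfl⟩ := QuotientGroup.mk_surjective x
    obtain ⟨l, hl⟩ := aux_nil (π i) (Nat.card (H i)) (fun x => pow_card_eq_one') θ.1 _ θ.2 hK
    refine ⟨k i * l, ?_⟩
    rw [← QuotientGroup.mk_pow, QuotientGroup.eq_one_iff, pow_mul, ← hk]
    exact hl
  let f : twoClosure G →* ∀ i, twoClosure G ⧸ auxM (π i) (twoClosure G) :=
    MonoidHom.pi fun i => QuotientGroup.mk' _
  have hf : Function.Injective f := by
    rw [injective_iff_map_eq_one]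
    intro θ hθ
    have hM : ∀ i, θ ∈ auxM (π i) (twoClosure G) := fun i =>
      (QuotientGroup.eq_one_iff θ).mp (congrFun hθ i)
    ext a
    obtain ⟨g, hg, _⟩ := hK θ.1 θ.2 a a
    have hmem : e.symm g ∈ (MulAction.stabilizer G a).comap e.toMonoidHom := by
      apply aux_prod
      · intro i j hij
        rw [hk, hk]
        exact Nat.Coprime.pow _ _ ((Nat.coprime_primes (hp i) (hp j)).mpr (hinj.ne hij))
      · intro i
        obtain ⟨x, hx, hxa⟩ := hM i a
        refine ⟨e.symm (x⁻¹ * g), ?_, ?_⟩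
        · rw [Subgroup.mem_comap, MulAction.mem_stabilizer_iff]
          simp only [MulEquiv.toMonoidHom_eq_coe, MonoidHom.coe_coe, MulEquiv.apply_symm_apply]
          rw [mul_smul, ← hg, hxa, inv_smul_smul]
        · have : e.symm x i = 1 := hx
          simp [this]
    rw [Subgroup.mem_comap, MulAction.mem_stabilizer_iff] at hmem
    simp only [MulEquiv.toMonoidHom_eq_coe, MonoidHom.coe_coe, MulEquiv.apply_symm_apply] at hmem
    rw [hg, hmem]; rfl
  exact Group.nilpotent_of_mulEquiv (MonoidHom.ofInjective hf).symm

theorem isNilpotent_iff_twoClosure_isNilpotent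
    {Ω : Type*} [Finite Ω] (G : Subgroup (Equiv.Perm Ω)) :
    Group.IsNilpotent G ↔ Group.IsNilpotent (twoClosure G) := by
  constructor
  · intro h
    obtain ⟨e⟩ := ((Group.isNilpotent_of_finite_tfae (G := G)).out 0 4).mp h
    have hF : ∀ q : (Nat.card G).primeFactors, Fact (q : ℕ).Prime :=
      fun q => ⟨Nat.prime_of_mem_primeFactors q.2⟩
    refine aux_main G (fun q : (Nat.card G).primeFactors => (q : ℕ)) (fun q => (hF q).out)
      (fun q => (Nat.card G).factorization q * Nat.card (Sylow q G)) ?_ Subtype.val_injective e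
    intro q
    have := hF q
    have := Fintype.ofFinite (Sylow q G)
    rw [Nat.card_pi, Finset.prod_congr rfl (fun P _ => Sylow.card_eq_multiplicity P)]
    simp [pow_mul]
  · intro h
    have hle : G ≤ twoClosure G := fun g hg a b => ⟨g, hg, rfl, rfl⟩
    exact Group.nilpotent_of_mulEquiv (Subgroup.subgroupOfEquivOfLe hle)
end

section
/- Let Ω be a finite set and let P be a property of subgroups of Sym(Ω) such that for every subgroup X ≤ Sym(Ω) with property P, the 2-closure X^{(2),Ω} also has property P. Let G ≤ Sym(Ω) satisfy G = G^{(2),Ω}, and let N be a normal subgroup of G which has property P and which contains every normal subgroup of G having property P. Then N = N^{(2),Ω}. -/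
theorem largest_normal_P_subgroup_two_closed
    {Ω : Type*} [Finite Ω]
    (Pr : Subgroup (Equiv.Perm Ω) → Prop)
    (hPr : ∀ X : Subgroup (Equiv.Perm Ω), Pr X → Pr (twoClosure X))
    (G : Subgroup (Equiv.Perm Ω)) (hG : twoClosure G = G)
    (N : Subgroup (Equiv.Perm Ω)) (hNG : N ≤ G)
    (hNnorm : (N.subgroupOf G).Normal) (hNP : Pr N)
    (hmax : ∀ M : Subgroup (Equiv.Perm Ω),
      M ≤ G → (M.subgroupOf G).Normal → Pr M → M ≤ N) :
    twoClosure N = N := by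
  apply le_antisymm
  · apply hmax _ _ _ (hPr N hNP)
    · intro θ hθ
      rw [← hG]
      intro α β
      obtain ⟨h, hh, e⟩ := hθ α β
      exact ⟨h, hNG hh, e⟩
    · constructor
      intro n hn g
      rw [Subgroup.mem_subgroupOf] at hn ⊢
      intro α β
      obtain ⟨h, hh, e1, e2⟩ := hn ((g : Equiv.Perm Ω)⁻¹ α) ((g : Equiv.Perm Ω)⁻¹ β)
      have key := hNnorm.conj_mem ⟨h, hNG hh⟩ (Subgroup.mem_subgroupOf.mpr hh) g
      rw [Subgroup.mem_subgroupOf] at key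
      refine ⟨_, key, ?_, ?_⟩
      · exact congrArg (g : Equiv.Perm Ω) e1
      · exact congrArg (g : Equiv.Perm Ω) e2
  · intro θ hθ α β
    exact ⟨θ, hθ, rfl, rfl⟩
end
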